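/- arXiv:1701.02695 — 3 statements merged into one kernel-verified Lean document; each statement's English description precedes it below -/
import Mathlib

section
/- (Sharkovskii's theorem) Let f : ℝ → ℝ be continuous. If f has a periodic point of period n, and m ◁ n in the Sharkovskii ordering, then f also has a periodic point of period m. -/
/-- `x` is a periodic point of `f` of (exact) period `n`. -/
def PeriodicPtOfPeriod (f : ℝ → ℝ) (n : ℕ) (x : ℝ) : Prop :=
  f^[n] x = x ∧ ∀ j, 1 ≤ j → j < n → f^[j] x ≠ x

/-- The Sharkovskii ordering `m ◁ n` on positive integers. -/
def SharkovskiiLt (m n : ℕ) : Prop :=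
  m ≠ n ∧ ∃ c d a b : ℕ, Odd d ∧ Odd b ∧ m = 2^c * d ∧ n = 2^a * b ∧
    ((d = 1 ∧ 1 < b) ∨ (d = 1 ∧ b = 1 ∧ c < a) ∨
     (1 < d ∧ 1 < b ∧ a < c) ∨ (1 < d ∧ 1 < b ∧ a = c ∧ b < d))

open Function Set

/-- `f` has a point of minimal period `n`. -/
def HasMinimalPeriod (f : ℝ → ℝ) (n : ℕ) : Prop := ∃ x, minimalPeriod f x = n

theorem periodicPtOfPeriod_iff {f : ℝ → ℝ} {n : ℕ} (hn : 0 < n) {x : ℝ} :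
    PeriodicPtOfPeriod f n x ↔ minimalPeriod f x = n := by
  constructor
  · rintro ⟨h, h'⟩
    have hp : IsPeriodicPt f n x := h
    have hle := hp.minimalPeriod_le hn
    by_contra hne
    exact h' _ (hp.minimalPeriod_pos hn) (lt_of_le_of_ne hle hne) (iterate_minimalPeriod (f := f))
  · rintro rfl
    exact ⟨iterate_minimalPeriod, fun j hj hlt h =>
      not_isPeriodicPt_of_pos_of_lt_minimalPeriod (by omega) hlt h⟩

/-- The map `f` modified so that it exchanges the two sides of its fixed point `z`. -/
noncomputable def fold (f : ℝ → ℝ) (z t : ℝ) : ℝ :=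
  max (f (min t z)) z + min (f (max t z)) z - z

section fold

variable {f : ℝ → ℝ} {z : ℝ}

theorem continuous_fold (hf : Continuous f) (z : ℝ) : Continuous (fold f z) := by
  unfold fold; fun_prop

theorem fold_of_le (hz : f z = z) {t : ℝ} (ht : t ≤ z) : fold f z t = max (f t) z := by
  simp [fold, ht, hz]

theorem fold_of_ge (hz : f z = z) {t : ℝ} (ht : z ≤ t) : fold f z t = min (f t) z := by
  simp [fold, ht, hz]

theorem fold_self (hz : f z = z) : fold f z z = z := by
  simp [fold, hz]

theorem le_fold (hz : f z = z) {t : ℝ} (ht : t ≤ z) : z ≤ fold f z t := by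
  simp [fold_of_le hz ht]

theorem fold_le (hz : f z = z) {t : ℝ} (ht : z ≤ t) : fold f z t ≤ z := by
  simp [fold_of_ge hz ht]

theorem fold_eq_of_ne (hz : f z = z) {t : ℝ} (h : fold f z t ≠ z) : fold f z t = f t := by
  rcases le_total t z with ht | ht
  · rw [fold_of_le hz ht] at h ⊢
    grind
  · rw [fold_of_ge hz ht] at h ⊢
    grind

theorem iterate_fold_self (hz : f z = z) (n : ℕ) : (fold f z)^[n] z = z :=
  iterate_fixed (fold_self hz) n

theorem iterate_fold_ne_of_le (hz : f z = z) {n i : ℕ} (hi : i ≤ n) {t : ℝ}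
    (h : (fold f z)^[n] t ≠ z) : (fold f z)^[i] t ≠ z := by
  intro h'
  obtain ⟨k, rfl⟩ := Nat.exists_eq_add_of_le' hi
  rw [iterate_add_apply, h', iterate_fold_self hz] at h
  exact h rfl

theorem iterate_fold_eq (hz : f z = z) {n : ℕ} {t : ℝ} (h : (fold f z)^[n] t ≠ z) :
    (fold f z)^[n] t = f^[n] t := by
  induction n with
  | zero => rfl
  | succ n ih =>
    have hn := ih (iterate_fold_ne_of_le hz n.le_succ h)
    rw [iterate_succ_apply'] at h ⊢
    rw [iterate_succ_apply', fold_eq_of_ne hz h, hn]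

theorem iterate_fold_even_le (hz : f z = z) {t : ℝ} (ht : t ≤ z) (k : ℕ) :
    (fold f z)^[2 * k] t ≤ z := by
  induction k with
  | zero => exact ht
  | succ k ih =>
    rw [Nat.mul_succ, add_comm, iterate_add_apply]
    exact fold_le hz (le_fold hz ih)

theorem le_iterate_fold_odd (hz : f z = z) {t : ℝ} (ht : t ≤ z) (k : ℕ) :
    z ≤ (fold f z)^[2 * k + 1] t := by
  rw [iterate_succ_apply']
  exact le_fold hz (iterate_fold_even_le hz ht k)

/-- A periodic point of the square of the folded map, away from the fixed point, is a periodic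
point of `f` of twice the period. -/
theorem minimalPeriod_of_fold (hz : f z = z) {y : ℝ} (hy : y < z) {k : ℕ} (hk : 0 < k)
    (h : minimalPeriod (fold f z)^[2] y = k) : minimalPeriod f y = 2 * k := by
  have hyk : (fold f z)^[2 * k] y = y := by
    rw [iterate_mul, ← h]; exact iterate_minimalPeriod
  have hne : ∀ i ≤ 2 * k, (fold f z)^[i] y ≠ z := fun i hi =>
    iterate_fold_ne_of_le hz hi (by rw [hyk]; exact hy.ne)
  have heq : ∀ i ≤ 2 * k, f^[i] y = (fold f z)^[i] y := fun i hi =>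
    (iterate_fold_eq hz (hne i hi)).symm
  rw [← periodicPtOfPeriod_iff (by omega)]
  refine ⟨by rw [heq _ le_rfl, hyk], fun j hj hlt hjy => ?_⟩
  rw [heq j hlt.le] at hjy
  rcases Nat.even_or_odd' j with ⟨i, rfl | rfl⟩
  · rw [iterate_mul] at hjy
    exact not_isPeriodicPt_of_pos_of_lt_minimalPeriod (f := (fold f z)^[2]) (n := i)
      (by omega) (by omega) hjy
  · linarith [le_iterate_fold_odd hz hy.le i]

end fold

/-- A point `x` left of the fixed point `z` that is not sent to the other side, together with a
point between them whose second image lies beyond `x`. -/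
def LeftHorseshoe (f : ℝ → ℝ) (z x : ℝ) : Prop :=
  f z = z ∧ f x ≤ z ∧ ∃ u, x < u ∧ u < z ∧ z < f u ∧ f (f u) ≤ x

/-- If `h u ≤ x < u` and `u ≤ h x`, then `h` has points of every period below `u`. -/
theorem exists_minimalPeriod_eq_of_turbulent {h : ℝ → ℝ} (hh : Continuous h) {x u z : ℝ}
    (hxu : x < u) (huz : u ≤ z) (hx : h x = z) (hz : h z = z) (hu : h u ≤ x) {k : ℕ}
    (hk : 0 < k) : ∃ y < u, minimalPeriod h y = k := by
  obtain ⟨n, rfl⟩ : ∃ n, k = n + 1 := ⟨k - 1, by omega⟩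
  let e : ℝ → ℝ := fun t => max u (h t)
  have he : Continuous e := by fun_prop
  have heu : e u = u := by simp only [e]; exact max_eq_left (hu.trans hxu.le)
  have hez : e z = z := by simp only [e, hz]; exact max_eq_right huz
  have hGx : h (e^[n] x) = z := by
    cases n with
    | zero => exact hx
    | succ n =>
      have : e x = z := by simp only [e, hx]; exact max_eq_right huz
      rw [iterate_succ_apply, this, iterate_fixed hez, hz]
  have hGu : h (e^[n] u) ≤ x := by rw [iterate_fixed heu]; exact hu
  obtain ⟨y, ⟨hxy, hyu⟩, hy⟩ : ∃ y ∈ Icc x u, h (e^[n] y) - y = 0 :=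
    intermediate_value_Icc' hxu.le (f := fun t => h (e^[n] t) - t) (by fun_prop)
      ⟨by linarith, by linarith⟩
  have hy : h (e^[n] y) = y := by linarith
  have hyu : y < u := by
    rcases hyu.lt_or_eq with h1 | rfl
    · exact h1
    · linarith
  have hxy : x < y := by
    rcases hxy.lt_or_eq with h1 | rfl
    · exact h1
    · linarith
  have hne : ∀ i ≤ n, e^[i] y ≠ u := by
    intro i hi h'
    obtain ⟨j, rfl⟩ := Nat.exists_eq_add_of_le' hi
    rw [iterate_add_apply, h', iterate_fixed heu] at hy
    linarith
  have heq : ∀ i ≤ n, e^[i] y = h^[i] y := by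
    intro i hi
    induction i with
    | zero => rfl
    | succ i ih =>
      have h1 := hne _ hi
      rw [iterate_succ_apply'] at h1 ⊢
      rw [iterate_succ_apply', ← ih (by omega)]
      simp only [e] at h1 ⊢
      grind
  refine ⟨y, hyu, (periodicPtOfPeriod_iff hk).1 ⟨?_, fun j hj hlt hjy => ?_⟩⟩
  · rw [iterate_succ_apply', ← heq n le_rfl, hy]
  · rw [← heq j (by omega)] at hjy
    obtain ⟨i, rfl⟩ : ∃ i, j = i + 1 := ⟨j - 1, by omega⟩
    rw [iterate_succ_apply'] at hjy
    have : u ≤ e (e^[i] y) := le_max_left _ _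
    linarith

namespace LeftHorseshoe

variable {f : ℝ → ℝ} {z x : ℝ}

theorem exists_fold (H : LeftHorseshoe f z x) :
    fold f z x = z ∧ ∃ u, x < u ∧ u < z ∧ (fold f z)^[2] u ≤ x := by
  obtain ⟨hz, hx, u, hxu, huz, hfu, hffu⟩ := H
  refine ⟨by rw [fold_of_le hz (hxu.trans huz).le, max_eq_right hx], u, hxu, huz, ?_⟩
  have h1 : fold f z u = f u := by rw [fold_of_le hz huz.le, max_eq_left hfu.le]
  change fold f z (fold f z u) ≤ x
  rw [h1, fold_of_ge hz hfu.le]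
  exact (min_le_left _ _).trans hffu

theorem hasMinimalPeriod_two_mul (H : LeftHorseshoe f z x) (hf : Continuous f) {k : ℕ}
    (hk : 0 < k) : HasMinimalPeriod f (2 * k) := by
  obtain ⟨hx, u, hxu, huz, hu⟩ := H.exists_fold
  obtain ⟨y, hyu, hy⟩ := exists_minimalPeriod_eq_of_turbulent
    ((continuous_fold hf z).iterate 2) hxu huz.le
    (by change fold f z (fold f z x) = z; rw [hx, fold_self H.1])
    (iterate_fold_self H.1 2) hu hk
  exact ⟨y, minimalPeriod_of_fold H.1 (hyu.trans huz) hk hy⟩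

theorem exists_odd_minimalPeriod (H : LeftHorseshoe f z x) (hf : Continuous f) {m : ℕ}
    (hm : f^[m] x = x) {k : ℕ} (hk : 0 < k) :
    ∃ y, f^[m + 2 * k] y = y ∧ ∀ j < 2 * k, Odd j → f^[j] y ≠ y := by
  obtain ⟨hx, u, hxu, huz, hu⟩ := H.exists_fold
  have hz := H.1
  set g := fold f z with hg
  have hgc : Continuous g := continuous_fold hf z
  have hxz := hxu.trans huz
  have hsurj : SurjOn g^[2] (Icc x z) (Icc x z) := by
    refine SurjOn.mono (Icc_subset_Icc_left hxu.le) (Icc_subset_Icc_left hu) ?_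
    have := intermediate_value_Icc huz.le (f := g^[2]) (hgc.iterate 2).continuousOn
    rwa [hg, iterate_fold_self hz] at this
  obtain ⟨b, ⟨hxb, hbz⟩, hb⟩ := hsurj.iterate k (left_mem_Icc.2 hxz.le)
  rw [← iterate_mul] at hb
  have hgx : g^[2 * k] x = z := by
    obtain ⟨i, hi⟩ : ∃ i, 2 * k = i + 1 := ⟨2 * k - 1, by omega⟩
    rw [hi, iterate_succ_apply, hx, hg, iterate_fold_self hz]
  have hgk : Continuous g^[2 * k] := hgc.iterate _
  -- the last point before `b` sent to `z`
  obtain ⟨a, ⟨⟨hxa, hab⟩, ha⟩, hmax⟩ : ∃ a, IsGreatest (Icc x b ∩ g^[2 * k] ⁻¹' {z}) a :=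
    (isCompact_Icc.inter_right (isClosed_singleton.preimage hgk)).exists_isGreatest
      ⟨x, ⟨le_rfl, hxb⟩, hgx⟩
  have ha : g^[2 * k] a = z := ha
  have hab : a < b := lt_of_le_of_ne hab (by rintro rfl; linarith)
  have hxb : x < b := hxa.trans_lt hab
  have hne : ∀ t ∈ Ioc a b, g^[2 * k] t ≠ z := fun t ht h =>
    not_lt.2 (hmax ⟨⟨hxa.trans ht.1.le, ht.2⟩, h⟩) ht.1
  have heq : EqOn g^[2 * k] f^[2 * k] (Icc a b) := by
    have : EqOn g^[2 * k] f^[2 * k] (Ioc a b) := fun t ht => iterate_fold_eq hz (hne t ht)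
    have := this.closure hgk (hf.iterate _)
    rwa [closure_Ioc hab.ne] at this
  have hfa : f^[m + 2 * k] a = z := by
    rw [iterate_add_apply, ← heq (left_mem_Icc.2 hab.le), ha, iterate_fixed hz]
  have hfb : f^[m + 2 * k] b = x := by
    rw [iterate_add_apply, ← heq (right_mem_Icc.2 hab.le), hb, hm]
  have hfc : Continuous f^[m + 2 * k] := hf.iterate _
  obtain ⟨y, hy, hfy⟩ : ∃ y ∈ Icc a b, f^[m + 2 * k] y - y = 0 :=
    intermediate_value_Icc' hab.le (f := fun t => f^[m + 2 * k] t - t) (by fun_prop)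
      ⟨by linarith, by linarith⟩
  have hfy : f^[m + 2 * k] y = y := by linarith
  have hay : a < y := lt_of_le_of_ne hy.1 (by rintro rfl; linarith)
  refine ⟨y, hfy, fun j hj ⟨i, hi⟩ hjy => ?_⟩
  have h1 := hne y ⟨hay, hy.2⟩
  have hyz : y < z := by
    refine lt_of_le_of_ne (hy.2.trans hbz) ?_
    rintro rfl
    exact h1 (iterate_fold_self hz _)
  rw [← iterate_fold_eq hz (iterate_fold_ne_of_le hz hj.le h1), hi] at hjy
  linarith [le_iterate_fold_odd hz hyz.le i]

end LeftHorseshoe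

/-- The conjugate of `f` by `t ↦ -t`. -/
def reflect (f : ℝ → ℝ) (t : ℝ) : ℝ := -f (-t)

theorem iterate_reflect (f : ℝ → ℝ) (n : ℕ) (t : ℝ) : (reflect f)^[n] t = -f^[n] (-t) := by
  induction n generalizing t with
  | zero => simp
  | succ n ih => rw [iterate_succ_apply, ih, reflect, neg_neg, iterate_succ_apply]

theorem continuous_reflect {f : ℝ → ℝ} (hf : Continuous f) : Continuous (reflect f) := by
  unfold reflect; fun_prop

theorem minimalPeriod_reflect (f : ℝ → ℝ) (t : ℝ) :
    minimalPeriod (reflect f) t = minimalPeriod f (-t) := by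
  rw [minimalPeriod_eq_minimalPeriod_iff]
  intro n
  rw [IsPeriodicPt, IsPeriodicPt, IsFixedPt, IsFixedPt, iterate_reflect, neg_eq_iff_eq_neg]

/-- The forward orbit of `p` under `f`. -/
def forwardOrbit (f : ℝ → ℝ) (p : ℝ) : Set ℝ := range fun i => f^[i] p

section forwardOrbit

variable {f : ℝ → ℝ} {p : ℝ}

theorem apply_mem_forwardOrbit {q : ℝ} (hq : q ∈ forwardOrbit f p) : f q ∈ forwardOrbit f p := by
  obtain ⟨i, rfl⟩ := hq
  exact ⟨i + 1, iterate_succ_apply' f i p⟩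

theorem minimalPeriod_of_mem_forwardOrbit (hp : 0 < minimalPeriod f p) {q : ℝ}
    (hq : q ∈ forwardOrbit f p) : minimalPeriod f q = minimalPeriod f p := by
  obtain ⟨i, rfl⟩ := hq
  exact minimalPeriod_apply_iterate (minimalPeriod_pos_iff_mem_periodicPts.1 hp) i

theorem apply_ne_of_mem_forwardOrbit (hp : 2 ≤ minimalPeriod f p) {q : ℝ}
    (hq : q ∈ forwardOrbit f p) : f q ≠ q := fun h => by
  have h1 := minimalPeriod_of_mem_forwardOrbit (by omega) hq
  have h2 : minimalPeriod f q = 1 := minimalPeriod_eq_one_iff_isFixedPt.2 h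
  omega

theorem finite_forwardOrbit (hp : 0 < minimalPeriod f p) : (forwardOrbit f p).Finite := by
  refine ((finite_Iio (minimalPeriod f p)).image fun i => f^[i] p).subset ?_
  rintro _ ⟨i, rfl⟩
  exact ⟨i % minimalPeriod f p, Nat.mod_lt _ hp, iterate_mod_minimalPeriod_eq⟩

theorem exists_iterate_eq_of_mem_forwardOrbit (hp : 0 < minimalPeriod f p) {q r : ℝ}
    (hq : q ∈ forwardOrbit f p) (hr : r ∈ forwardOrbit f p) : ∃ i, f^[i] q = r := by
  obtain ⟨i, rfl⟩ := hq
  obtain ⟨j, rfl⟩ := hr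
  refine ⟨j + (minimalPeriod f p * i - i), ?_⟩
  have h1 : i ≤ minimalPeriod f p * i := Nat.le_mul_of_pos_left i hp
  rw [← iterate_add_apply, add_assoc, Nat.sub_add_cancel h1, iterate_add_apply]
  congr 1
  exact (isPeriodicPt_minimalPeriod f p).mul_const i

/-- A periodic orbit surrounds a fixed point whose two neighbours on the orbit are exchanged
between the sides. -/
theorem exists_center (hf : Continuous f) (hp : 2 ≤ minimalPeriod f p) :
    ∃ z, f z = z ∧ ∃ a ∈ forwardOrbit f p, ∃ b ∈ forwardOrbit f p, a < z ∧ z < b ∧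
      z ≤ f a ∧ f b ≤ z ∧ ∀ q ∈ forwardOrbit f p, q ≤ a ∨ b ≤ q := by
  set P := forwardOrbit f p with hP
  have hfin : P.Finite := finite_forwardOrbit (by omega)
  have hmem : ∀ q ∈ P, f q ∈ P := fun q hq => apply_mem_forwardOrbit hq
  have hne : ∀ q ∈ P, f q ≠ q := fun q hq => apply_ne_of_mem_forwardOrbit hp hq
  obtain ⟨c, hc, hcmin⟩ := exists_min_image P id hfin ⟨p, 0, rfl⟩
  obtain ⟨a, ⟨haP, ha⟩, hamax⟩ := exists_max_image {q ∈ P | q < f q} id (hfin.sep _)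
    ⟨c, hc, lt_of_le_of_ne (hcmin _ (hmem c hc)) (hne c hc).symm⟩
  obtain ⟨b, ⟨hbP, hab⟩, hbmin⟩ := exists_min_image {q ∈ P | a < q} id (hfin.sep _)
    ⟨f a, hmem a haP, ha⟩
  have hfb : f b < b := by
    refine lt_of_le_of_ne (not_lt.1 fun h => ?_) (hne b hbP)
    exact absurd (hamax b ⟨hbP, h⟩) (not_le.2 hab)
  have hfba : f b ≤ a := not_lt.1 fun h =>
    absurd (hbmin (f b) ⟨hmem b hbP, h⟩) (not_le.2 hfb)
  have hfab : b ≤ f a := hbmin (f a) ⟨hmem a haP, ha⟩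
  obtain ⟨z, ⟨haz, hzb⟩, hz⟩ : ∃ z ∈ Icc a b, f z - z = 0 :=
    intermediate_value_Icc' hab.le (f := fun t => f t - t) (by fun_prop)
      ⟨by linarith, by linarith⟩
  have hz : f z = z := by linarith
  refine ⟨z, hz, a, haP, b, hbP, lt_of_le_of_ne haz ?_, lt_of_le_of_ne hzb ?_, by linarith,
    by linarith, fun q hq => ?_⟩
  · rintro rfl; exact hne _ haP hz
  · rintro rfl; exact hne _ hbP hz
  · by_contra! h
    exact absurd (hbmin q ⟨hq, h.1⟩) (not_le.2 h.2)

/-- A set invariant under the folded map, on which the orbit of `p` is not affected by folding,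
contains the whole orbit as soon as it meets it. -/
theorem forwardOrbit_subset_of_mapsTo_fold (hp : 0 < minimalPeriod f p) {z : ℝ} {T : Set ℝ}
    (hT : MapsTo (fold f z) T T) (heq : ∀ q ∈ forwardOrbit f p, q ∈ T → fold f z q = f q)
    {r : ℝ} (hr : r ∈ forwardOrbit f p) (hrT : r ∈ T) : forwardOrbit f p ⊆ T := by
  intro q hq
  obtain ⟨i, rfl⟩ := exists_iterate_eq_of_mem_forwardOrbit hp hr hq
  have : ∀ i, f^[i] r ∈ forwardOrbit f p ∧ f^[i] r ∈ T := by
    intro i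
    induction i with
    | zero => exact ⟨hr, hrT⟩
    | succ i ih =>
      rw [iterate_succ_apply']
      refine ⟨apply_mem_forwardOrbit ih.1, ?_⟩
      rw [← heq _ ih.1 ih.2]
      exact hT ih.2
  exact (this i).2

theorem leftHorseshoe_of_fold {z x u : ℝ} (hz : f z = z) (hxz : x < z) (hx : fold f z x ≠ f x)
    (hxu : x ≤ u) (huz : u ≤ z) (hu : (fold f z)^[2] u ≤ x) : LeftHorseshoe f z x := by
  have hgx : fold f z x = z := by
    by_contra h; exact hx (fold_eq_of_ne hz h)
  have hu' : fold f z (fold f z u) ≤ x := hu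
  have h1 : fold f z (fold f z u) ≠ z := (hu'.trans_lt hxz).ne
  have h2 : fold f z u ≠ z := fun h => h1 (by rw [h, fold_self hz])
  have h3 := fold_eq_of_ne hz h1
  have h4 := fold_eq_of_ne hz h2
  refine ⟨hz, ?_, u, lt_of_le_of_ne hxu ?_, lt_of_le_of_ne huz ?_, ?_, ?_⟩
  · rw [fold_of_le hz hxz.le] at hgx
    exact max_eq_right_iff.1 hgx
  · rintro rfl; exact h2 hgx
  · rintro rfl; exact h2 (fold_self hz)
  · rw [← h4]; exact lt_of_le_of_ne (le_fold hz huz) h2.symm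
  · rw [← h4, ← h3]; exact hu'

theorem fold_reflect (f : ℝ → ℝ) (z t : ℝ) : fold (reflect f) (-z) (-t) = -fold f z t := by
  simp only [fold, reflect, min_neg_neg, max_neg_neg, neg_neg]
  ring

theorem exists_leftHorseshoe (hf : Continuous f) (hp : 2 ≤ minimalPeriod f p) {z a b : ℝ}
    (hz : f z = z) (ha : a ∈ forwardOrbit f p) (hb : b ∈ forwardOrbit f p) (haz : a < z)
    (hzb : z < b) (hfa : z ≤ f a) (hfb : f b ≤ z)
    (hab : ∀ q ∈ forwardOrbit f p, q ≤ a ∨ b ≤ q) {q : ℝ} (hq : q ∈ forwardOrbit f p)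
    (hfq : fold f z q ≠ f q) :
    ∃ x ∈ forwardOrbit f p, LeftHorseshoe f z x ∨ LeftHorseshoe (reflect f) (-z) (-x) := by
  by_contra! H
  have hp0 : 0 < minimalPeriod f p := by omega
  set P := forwardOrbit f p with hP
  set g := fold f z with hg
  have hgc : Continuous g := continuous_fold hf z
  have hgz : g z = z := fold_self hz
  have hfin : P.Finite := finite_forwardOrbit hp0
  have hPz : ∀ q ∈ P, q ≠ z := by
    rintro _ hq rfl
    exact apply_ne_of_mem_forwardOrbit hp hq hz
  have hga : g a = f a := by rw [hg, fold_of_le hz haz.le, max_eq_left hfa]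
  have hgb : g b = f b := by rw [hg, fold_of_ge hz hzb.le, min_eq_left hfb]
  let A : Set ℝ := {q ∈ P | q < z ∧ g q ≠ f q}
  let B : Set ℝ := {q ∈ P | z < q ∧ g q ≠ f q}
  have hA : ∀ x ∈ A, ∀ u ∈ Icc x z, x < g (g u) := by
    intro x hx u hu
    by_contra! h
    exact (H x hx.1).1 (leftHorseshoe_of_fold hz hx.2.1 hx.2.2 hu.1 hu.2 h)
  have hB : ∀ y ∈ B, ∀ u ∈ Icc z y, g (g u) < y := by
    intro y hy u hu
    by_contra! h
    refine (H y hy.1).2 (leftHorseshoe_of_fold (u := -u) ?_ (neg_lt_neg hy.2.1) ?_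
      (neg_le_neg hu.2) (neg_le_neg hu.1) ?_)
    · rw [reflect, neg_neg, hz]
    · rw [fold_reflect, reflect, neg_neg]
      exact fun h => hy.2.2 (neg_injective h)
    · change fold _ _ (fold _ _ _) ≤ _
      rw [fold_reflect, fold_reflect]
      exact neg_le_neg h
  have hAB : ∀ x ∈ A, (∀ x' ∈ A, x' ≤ x) → ∃ y ∈ B, y ∈ g '' Icc x z := by
    intro x hx hmax
    by_contra! hno
    have hT : MapsTo g (Ioc x z ∪ g '' Icc x z) (Ioc x z ∪ g '' Icc x z) := by
      rintro t (ht | ⟨t, ht, rfl⟩)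
      · exact Or.inr ⟨t, Ioc_subset_Icc_self ht, rfl⟩
      · exact Or.inl ⟨hA x hx t ht, fold_le hz (le_fold hz ht.2)⟩
    have hxa : a ∈ Ioc x z := by
      refine ⟨lt_of_le_of_ne ((hab x hx.1).resolve_right ?_) ?_, haz.le⟩
      · linarith [hx.2.1]
      · rintro rfl; exact hx.2.2 hga
    have heq : ∀ q ∈ P, q ∈ Ioc x z ∪ g '' Icc x z → g q = f q := by
      rintro q hq (h | h)
      · by_contra hne
        linarith [hmax q ⟨hq, lt_of_le_of_ne h.2 (hPz q hq), hne⟩, h.1]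
      · by_contra hne
        refine hno q ⟨hq, lt_of_le_of_ne ?_ (hPz q hq).symm, hne⟩ h
        obtain ⟨t, ht, rfl⟩ := h
        exact le_fold hz ht.2
    rcases forwardOrbit_subset_of_mapsTo_fold hp0 hT heq ha (Or.inl hxa) hx.1 with h | ⟨t, ht, h⟩
    · exact lt_irrefl _ h.1
    · have : z ≤ g t := le_fold hz ht.2
      linarith [hx.2.1]
  have hBA : ∀ y ∈ B, (∀ y' ∈ B, y ≤ y') → ∃ x ∈ A, x ∈ g '' Icc z y := by
    intro y hy hmin
    by_contra! hno
    have hT : MapsTo g (Ico z y ∪ g '' Icc z y) (Ico z y ∪ g '' Icc z y) := by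
      rintro t (ht | ⟨t, ht, rfl⟩)
      · exact Or.inr ⟨t, Ico_subset_Icc_self ht, rfl⟩
      · exact Or.inl ⟨le_fold hz (fold_le hz ht.1), hB y hy t ht⟩
    have hyb : b ∈ Ico z y := by
      refine ⟨hzb.le, lt_of_le_of_ne ((hab y hy.1).resolve_left ?_) ?_⟩
      · linarith [hy.2.1]
      · rintro rfl; exact hy.2.2 hgb
    have heq : ∀ q ∈ P, q ∈ Ico z y ∪ g '' Icc z y → g q = f q := by
      rintro q hq (h | h)
      · by_contra hne
        linarith [hmin q ⟨hq, lt_of_le_of_ne h.1 (hPz q hq).symm, hne⟩, h.2]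
      · by_contra hne
        refine hno q ⟨hq, lt_of_le_of_ne ?_ (hPz q hq), hne⟩ h
        obtain ⟨t, ht, rfl⟩ := h
        exact fold_le hz ht.1
    rcases forwardOrbit_subset_of_mapsTo_fold hp0 hT heq hb (Or.inl hyb) hy.1 with h | ⟨t, ht, h⟩
    · exact lt_irrefl _ h.2
    · have : g t ≤ z := fold_le hz ht.1
      linarith [hy.2.1]
  have hAne : A.Nonempty := by
    rcases (hPz q hq).lt_or_gt with h | h
    · exact ⟨q, hq, h, hfq⟩
    · obtain ⟨y, hy, hmin⟩ := exists_min_image B id (hfin.sep _) ⟨q, hq, h, hfq⟩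
      obtain ⟨x, hx, -⟩ := hBA y hy hmin
      exact ⟨x, hx⟩
  obtain ⟨x, hx, hmax⟩ := exists_max_image A id (hfin.sep _) hAne
  obtain ⟨y₁, hy₁, t, ht, rfl⟩ := hAB x hx hmax
  obtain ⟨y, hy, hmin⟩ := exists_min_image B id (hfin.sep _) ⟨_, hy₁⟩
  obtain ⟨x₁, hx₁, s, hs, rfl⟩ := hBA y hy hmin
  obtain ⟨r, hr, rfl⟩ : s ∈ g '' Icc t z := by
    refine intermediate_value_Icc' ht.2 hgc.continuousOn ⟨?_, hs.2.trans (hmin _ hy₁)⟩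
    rw [hgz]; exact hs.1
  exact not_lt.2 (hmax _ hx₁) (hA x hx r ⟨ht.1.trans hr.1, hr.2⟩)

theorem fold_iterate_eq_of_forall {z : ℝ}
    (h : ∀ q ∈ forwardOrbit f p, fold f z q = f q) {q : ℝ} (hq : q ∈ forwardOrbit f p) (n : ℕ) :
    (fold f z)^[n] q = f^[n] q := by
  induction n generalizing q with
  | zero => rfl
  | succ n ih =>
    rw [iterate_succ_apply, iterate_succ_apply, h q hq, ih (apply_mem_forwardOrbit hq)]

/-- If every orbit point changes sides of `z`, then `f` has a point of period two. -/
theorem hasMinimalPeriod_two_of_fold_eq (hf : Continuous f) (hp : 3 ≤ minimalPeriod f p)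
    {z a : ℝ} (hz : f z = z) (ha : a ∈ forwardOrbit f p) (haz : a < z)
    (h : ∀ q ∈ forwardOrbit f p, fold f z q = f q) : HasMinimalPeriod f 2 := by
  set g := fold f z with hg
  have hgc : Continuous g^[2] := (continuous_fold hf z).iterate 2
  let L : Set ℝ := {q ∈ forwardOrbit f p | q < z}
  have hfin : L.Finite := (finite_forwardOrbit (by omega)).sep _
  have hmem : ∀ q ∈ L, g^[2] q ∈ L := by
    intro q hq
    have h1 : g^[2] q ∈ forwardOrbit f p := by
      rw [fold_iterate_eq_of_forall h hq.1]
      exact apply_mem_forwardOrbit (apply_mem_forwardOrbit hq.1)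
    refine ⟨h1, lt_of_le_of_ne (iterate_fold_even_le hz hq.2.le 1) fun h2 => ?_⟩
    exact apply_ne_of_mem_forwardOrbit (by omega) h1 (by rw [h2, hz])
  have hne : ∀ q ∈ L, g^[2] q ≠ q := by
    intro q hq h1
    rw [fold_iterate_eq_of_forall h hq.1] at h1
    have h2 := minimalPeriod_of_mem_forwardOrbit (by omega) hq.1
    exact not_isPeriodicPt_of_pos_of_lt_minimalPeriod two_ne_zero (by omega) h1
  obtain ⟨c, hc, hmin⟩ := exists_min_image L id hfin ⟨a, ha, haz⟩
  obtain ⟨d, hd, hmax⟩ := exists_max_image L id hfin ⟨a, ha, haz⟩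
  have hcd : c ≤ d := hmin d hd
  have h1 : c ≤ g^[2] c := hmin _ (hmem c hc)
  have h2 : g^[2] d ≤ d := hmax _ (hmem d hd)
  obtain ⟨y, hy, hgy⟩ : ∃ y ∈ Icc c d, g^[2] y - y = 0 :=
    intermediate_value_Icc' hcd (f := fun t => g^[2] t - t) (by fun_prop)
      ⟨by linarith, by linarith⟩
  refine ⟨y, minimalPeriod_of_fold hz (hy.2.trans_lt hd.2) one_pos
    (minimalPeriod_eq_one_iff_isFixedPt.2 ?_)⟩
  exact sub_eq_zero.1 hgy

end forwardOrbit

theorem HasMinimalPeriod.of_reflect {f : ℝ → ℝ} {n : ℕ} (h : HasMinimalPeriod (reflect f) n) :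
    HasMinimalPeriod f n := by
  obtain ⟨x, hx⟩ := h
  exact ⟨-x, by rw [← minimalPeriod_reflect, hx]⟩

section periods

variable {f : ℝ → ℝ}

theorem HasMinimalPeriod.two_of_three_le (hf : Continuous f) {m : ℕ} (hm : 3 ≤ m)
    (h : HasMinimalPeriod f m) : HasMinimalPeriod f 2 := by
  obtain ⟨p, rfl⟩ := h
  obtain ⟨z, hz, a, ha, b, hb, haz, hzb, hfa, hfb, hab⟩ :=
    exists_center hf (show 2 ≤ minimalPeriod f p by omega)
  by_cases hall : ∀ q ∈ forwardOrbit f p, fold f z q = f q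
  · exact hasMinimalPeriod_two_of_fold_eq hf hm hz ha haz hall
  · push Not at hall
    obtain ⟨q, hq, hfq⟩ := hall
    obtain ⟨x, -, H | H⟩ :=
      exists_leftHorseshoe hf (by omega) hz ha hb haz hzb hfa hfb hab hq hfq
    · exact H.hasMinimalPeriod_two_mul hf one_pos
    · exact (H.hasMinimalPeriod_two_mul (continuous_reflect hf) one_pos).of_reflect

theorem HasMinimalPeriod.one_of_two_le (hf : Continuous f) {m : ℕ} (hm : 2 ≤ m)
    (h : HasMinimalPeriod f m) : HasMinimalPeriod f 1 := by
  obtain ⟨p, rfl⟩ := h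
  obtain ⟨z, hz, -⟩ := exists_center hf hm
  exact ⟨z, minimalPeriod_eq_one_iff_isFixedPt.2 hz⟩

theorem exists_leftHorseshoe_of_odd (hf : Continuous f) {p : ℝ} (hp : 1 < minimalPeriod f p)
    (hodd : Odd (minimalPeriod f p)) : ∃ x z, minimalPeriod f x = minimalPeriod f p ∧
      (LeftHorseshoe f z x ∨ LeftHorseshoe (reflect f) (-z) (-x)) := by
  obtain ⟨z, hz, a, ha, b, hb, haz, hzb, hfa, hfb, hab⟩ := exists_center hf hp
  by_cases hall : ∀ q ∈ forwardOrbit f p, fold f z q = f q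
  · obtain ⟨i, hi⟩ := hodd
    have h1 := le_iterate_fold_odd hz haz.le i
    rw [← hi, fold_iterate_eq_of_forall hall ha,
      ← minimalPeriod_of_mem_forwardOrbit (by omega) ha, iterate_minimalPeriod] at h1
    linarith
  · push Not at hall
    obtain ⟨q, hq, hfq⟩ := hall
    obtain ⟨x, hx, H⟩ := exists_leftHorseshoe hf hp hz ha hb haz hzb hfa hfb hab hq hfq
    exact ⟨x, z, minimalPeriod_of_mem_forwardOrbit (by omega) hx, H⟩

theorem HasMinimalPeriod.two_mul_of_odd (hf : Continuous f) {m : ℕ} (hm : 1 < m) (hodd : Odd m)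
    (h : HasMinimalPeriod f m) {k : ℕ} (hk : 0 < k) : HasMinimalPeriod f (2 * k) := by
  obtain ⟨p, rfl⟩ := h
  obtain ⟨x, z, -, H | H⟩ := exists_leftHorseshoe_of_odd hf hm hodd
  · exact H.hasMinimalPeriod_two_mul hf hk
  · exact (H.hasMinimalPeriod_two_mul (continuous_reflect hf) hk).of_reflect

theorem HasMinimalPeriod.odd_of_odd_lt (hf : Continuous f) {m l : ℕ} (hm : 1 < m) (hodd : Odd m)
    (h : HasMinimalPeriod f m) (hl : Odd l) (hml : m < l) : HasMinimalPeriod f l := by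
  classical
  have hex : ∃ m, 1 < m ∧ Odd m ∧ HasMinimalPeriod f m := ⟨m, hm, hodd, h⟩
  obtain ⟨m₀, ⟨hm₀, hodd₀, p, hp⟩, hmin⟩ : ∃ m₀, (1 < m₀ ∧ Odd m₀ ∧ HasMinimalPeriod f m₀) ∧
      ∀ d, 1 < d → Odd d → HasMinimalPeriod f d → m₀ ≤ d :=
    ⟨Nat.find hex, Nat.find_spec hex, fun d h1 h2 h3 => Nat.find_min' hex ⟨h1, h2, h3⟩⟩
  have hlt : m₀ < l := (hmin m hm hodd h).trans_lt hml
  obtain ⟨k, hk, rfl⟩ : ∃ k, 0 < k ∧ l = m₀ + 2 * k := by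
    obtain ⟨i, rfl⟩ := hl
    obtain ⟨j, rfl⟩ := hodd₀
    exact ⟨i - j, by omega, by omega⟩
  obtain ⟨y, hy, hyj⟩ : ∃ y, f^[m₀ + 2 * k] y = y ∧ ∀ j < 2 * k, Odd j → f^[j] y ≠ y := by
    subst hp
    obtain ⟨x, z, hx, H | H⟩ := exists_leftHorseshoe_of_odd hf hm₀ hodd₀
    · exact H.exists_odd_minimalPeriod hf (by rw [← hx, iterate_minimalPeriod]) hk
    · obtain ⟨y, hy, hyj⟩ := H.exists_odd_minimalPeriod (continuous_reflect hf)
        (m := minimalPeriod f p)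
        (by rw [iterate_reflect, neg_neg, ← hx, iterate_minimalPeriod]) hk
      refine ⟨-y, ?_, fun j hj ho hjy => hyj j hj ho ?_⟩
      · rw [iterate_reflect] at hy
        exact neg_eq_iff_eq_neg.1 hy
      · rw [iterate_reflect, hjy, neg_neg]
  obtain ⟨c, hc⟩ : minimalPeriod f y ∣ m₀ + 2 * k :=
    isPeriodicPt_iff_minimalPeriod_dvd.1 hy
  have hodds := hl
  rw [hc, Nat.odd_mul] at hodds
  have hge : 2 * k ≤ minimalPeriod f y := not_lt.1 fun hd =>
    hyj _ hd hodds.1 iterate_minimalPeriod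
  have hle := hmin _ (by omega) hodds.1 ⟨y, rfl⟩
  obtain ⟨i, rfl⟩ := hodds.2
  rcases i with _ | i
  · exact ⟨y, by rw [hc]; simp⟩
  · nlinarith

theorem HasMinimalPeriod.iterate {m n : ℕ} (hn : n ≠ 0) (h : HasMinimalPeriod f (n * m)) :
    HasMinimalPeriod f^[n] m := by
  obtain ⟨x, hx⟩ := h
  refine ⟨x, ?_⟩
  rw [minimalPeriod_iterate_eq_div_gcd hn, hx, Nat.gcd_mul_right_left,
    Nat.mul_div_cancel_left _ (Nat.pos_of_ne_zero hn)]

theorem exists_minimalPeriod_eq_two_pow_mul {a m : ℕ} {x : ℝ}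
    (hx : minimalPeriod f^[2 ^ a] x = m) :
    ∃ s ≤ a, (minimalPeriod f x).gcd (2 ^ a) = 2 ^ s ∧ minimalPeriod f x = 2 ^ s * m := by
  rw [minimalPeriod_iterate_eq_div_gcd (by positivity)] at hx
  obtain ⟨s, hs, hgcd⟩ :=
    (Nat.dvd_prime_pow Nat.prime_two).1 (Nat.gcd_dvd_right (minimalPeriod f x) (2 ^ a))
  have hdiv := Nat.gcd_dvd_left (minimalPeriod f x) (2 ^ a)
  rw [hgcd] at hx hdiv
  exact ⟨s, hs, hgcd, by rw [← hx, Nat.mul_div_cancel' hdiv]⟩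

theorem HasMinimalPeriod.of_iterate_two_pow {a m : ℕ} (hm : Even m) (hm0 : m ≠ 0)
    (h : HasMinimalPeriod f^[2 ^ a] m) : HasMinimalPeriod f (2 ^ a * m) := by
  obtain ⟨x, hx⟩ := h
  refine ⟨x, ?_⟩
  obtain ⟨s, hs, hgcd, hper⟩ := exists_minimalPeriod_eq_two_pow_mul hx
  rcases hs.lt_or_eq with hlt | rfl
  · obtain ⟨r, rfl⟩ := hm.two_dvd
    have h1 : 2 ^ (s + 1) ∣ 2 ^ s := by
      refine (Nat.dvd_gcd ?_ (pow_dvd_pow 2 hlt)).trans hgcd.dvd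
      rw [hper, pow_succ]
      exact mul_dvd_mul_left _ (dvd_mul_right 2 r)
    exact absurd (Nat.le_of_dvd (by positivity) h1)
      (not_le.2 (Nat.pow_lt_pow_right one_lt_two s.lt_succ_self))
  · exact hper

theorem HasMinimalPeriod.two_pow_of_le (hf : Continuous f) {a c : ℕ} (hca : c ≤ a)
    (h : HasMinimalPeriod f (2 ^ a)) : HasMinimalPeriod f (2 ^ c) := by
  induction a, hca using Nat.le_induction with
  | base => exact h
  | succ a _ ih =>
    refine ih ?_
    rcases a with _ | a
    · exact h.one_of_two_le hf (by norm_num)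
    · rw [pow_succ]
      refine HasMinimalPeriod.of_iterate_two_pow even_two two_ne_zero ?_
      refine HasMinimalPeriod.two_of_three_le (hf.iterate _) (m := 4) (by norm_num) ?_
      refine HasMinimalPeriod.iterate (by positivity) ?_
      convert h using 1
      ring

theorem HasMinimalPeriod.two_pow_mul (hf : Continuous f) {a b c d : ℕ} (hb : 1 < b)
    (hbo : Odd b) (hd : 0 < d) (hac : a < c) (h : HasMinimalPeriod f (2 ^ a * b)) :
    HasMinimalPeriod f (2 ^ c * d) := by
  obtain ⟨i, rfl⟩ := Nat.exists_eq_add_of_lt hac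
  have h1 := (h.iterate (by positivity)).two_mul_of_odd (hf.iterate _) hb hbo
    (k := 2 ^ i * d) (by positivity)
  convert h1.of_iterate_two_pow (even_two_mul _) (by positivity) using 1
  ring

theorem HasMinimalPeriod.two_pow_mul_odd (hf : Continuous f) {a b d : ℕ} (hb : 1 < b)
    (hbo : Odd b) (hdo : Odd d) (hbd : b < d) (h : HasMinimalPeriod f (2 ^ a * b)) :
    HasMinimalPeriod f (2 ^ a * d) := by
  obtain ⟨x, hx⟩ := (h.iterate (by positivity)).odd_of_odd_lt (hf.iterate _) hb hbo hdo hbd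
  obtain ⟨s, hs, -, hper⟩ := exists_minimalPeriod_eq_two_pow_mul hx
  rcases hs.lt_or_eq with hlt | rfl
  · exact HasMinimalPeriod.two_pow_mul hf (by omega) hdo (by omega) hlt ⟨x, hper⟩
  · exact ⟨x, hper⟩

end periods

/-- Sharkovskii's theorem. -/
theorem sharkovskii (f : ℝ → ℝ) (hf : Continuous f) (m n : ℕ)
    (hmn : SharkovskiiLt m n) (hn : ∃ x, PeriodicPtOfPeriod f n x) :
    ∃ y, PeriodicPtOfPeriod f m y := by
  obtain ⟨-, c, d, a, b, hd, hb, rfl, rfl, hcases⟩ := hmn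
  have hd0 := hd.pos
  have hb0 := hb.pos
  have h : HasMinimalPeriod f (2 ^ a * b) := by
    obtain ⟨x, hx⟩ := hn
    exact ⟨x, (periodicPtOfPeriod_iff (by positivity)).1 hx⟩
  suffices H : HasMinimalPeriod f (2 ^ c * d) by
    obtain ⟨y, hy⟩ := H
    exact ⟨y, (periodicPtOfPeriod_iff (by positivity)).2 hy⟩
  rcases hcases with ⟨rfl, hb1⟩ | ⟨rfl, rfl, hca⟩ | ⟨-, hb1, hac⟩ | ⟨-, hb1, rfl, hbd⟩
  · rcases lt_or_ge a c with hac | hca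
    · exact h.two_pow_mul hf hb1 hb one_pos hac
    · have h1 := h.two_pow_mul hf hb1 hb one_pos a.lt_succ_self
      rw [mul_one] at h1 ⊢
      exact h1.two_pow_of_le hf (by omega)
  · rw [mul_one] at h ⊢
    exact h.two_pow_of_le hf hca.le
  · exact h.two_pow_mul hf hb1 hb hd0 hac
  · exact h.two_pow_mul_odd hf hb1 hb hd hbd
end

section
/- Let k ≥ 3, let f : ℝ → ℝ be continuous, and let B be a second minimal (2k+1)-orbit of f. Then B is simple: its permutation σ is simple of positive type or simple of negative type. -/
/-- `β 1 < β 2 < ⋯ < β m` is an `m`-orbit of `f` with permutation `σ`: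
each `β t` is a periodic point of period `m`, `σ` permutes `{1,…,m}`,
and `f (β t) = β (σ t)`. -/
def IsOrbitWithPerm (f : ℝ → ℝ) (m : ℕ) (β : ℕ → ℝ) (σ : ℕ → ℕ) : Prop :=
  StrictMonoOn β (Set.Icc 1 m) ∧
  (∀ t ∈ Set.Icc 1 m, PeriodicPtOfPeriod f m (β t)) ∧
  Set.BijOn σ (Set.Icc 1 m) (Set.Icc 1 m) ∧
  (∀ t ∈ Set.Icc 1 m, f (β t) = β (σ t))

/-- A `(2k+1)`-orbit `β` of `f` is second minimal: `f` has a periodic point of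
period `2k−1` with forward orbit in `[β 1, β (2k+1)]`, and no periodic point of
odd period `q` with `1 < q < 2k−1` whose forward orbit lies in `[β 1, β (2k+1)]`. -/
def SecondMinimalOrbit (f : ℝ → ℝ) (k : ℕ) (β : ℕ → ℝ) : Prop :=
  (∃ y, PeriodicPtOfPeriod f (2*k-1) y ∧
      ∀ j : ℕ, f^[j] y ∈ Set.Icc (β 1) (β (2*k+1))) ∧
  ∀ q, Odd q → 1 < q → q < 2*k-1 →
    ¬ ∃ y, PeriodicPtOfPeriod f q y ∧
        ∀ j : ℕ, f^[j] y ∈ Set.Icc (β 1) (β (2*k+1))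

/-- A permutation of `{1,…,2k+1}` is simple of positive type. -/
def SimplePos (k : ℕ) (σ : ℕ → ℕ) : Prop :=
  (∀ t ∈ Set.Icc (k+2) (2*k+1), σ t ∈ Set.Icc 1 (k+1)) ∧
  ∃! p, p ∈ Set.Icc 1 (k+1) ∧ σ p ∈ Set.Icc 1 (k+1)

/-- A permutation of `{1,…,2k+1}` is simple of negative type. -/
def SimpleNeg (k : ℕ) (σ : ℕ → ℕ) : Prop :=
  (∀ t ∈ Set.Icc 1 k, σ t ∈ Set.Icc (k+1) (2*k+1)) ∧
  ∃! q, q ∈ Set.Icc (k+1) (2*k+1) ∧ σ q ∈ Set.Icc (k+1) (2*k+1)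

open Set

/-- A continuous function taking the values `c ≤ d` takes them at two points such that it stays
within `[c, d]` in between. -/
theorem exists_uIcc_mapsTo_Icc {h : ℝ → ℝ} (hc : Continuous h) {x y c d : ℝ}
    (hcd : c ≤ d) (hx : h x = c) (hy : h y = d) :
    ∃ u v, u ∈ uIcc x y ∧ v ∈ uIcc x y ∧ h u = c ∧ h v = d ∧ ∀ z ∈ uIcc u v, h z ∈ Icc c d := by
  let S : Set (ℝ × ℝ) := (uIcc x y ×ˢ uIcc x y) ∩ {w | h w.1 = c ∧ h w.2 = d}
  have hScomp : IsCompact S := by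
    refine (isCompact_uIcc.prod isCompact_uIcc).inter_right ?_
    exact (isClosed_eq (by fun_prop) continuous_const).inter
      (isClosed_eq (by fun_prop) continuous_const)
  have hSne : S.Nonempty := ⟨(x, y), ⟨⟨left_mem_uIcc, right_mem_uIcc⟩, hx, hy⟩⟩
  obtain ⟨⟨u, v⟩, ⟨⟨hu, hv⟩, huc, hvd⟩, hmin⟩ := hScomp.exists_isMinOn hSne
    (f := fun w : ℝ × ℝ => |w.1 - w.2|) (by fun_prop)
  simp only at hu hv huc hvd
  have hsub : uIcc u v ⊆ uIcc x y := uIcc_subset_uIcc hu hv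
  refine ⟨u, v, hu, hv, huc, hvd, fun z hz => ⟨?_, ?_⟩⟩
  · by_contra! hlt
    obtain ⟨w, hw, hwc⟩ : c ∈ h '' uIcc z v :=
      intermediate_value_uIcc hc.continuousOn (mem_uIcc.2 (Or.inl ⟨hlt.le, hvd ▸ hcd⟩))
    have hwz : w ≠ z := by rintro rfl; exact hlt.ne hwc
    have hmem : (w, v) ∈ S :=
      ⟨⟨hsub (uIcc_subset_uIcc hz right_mem_uIcc hw), hv⟩, hwc, hvd⟩
    have hle : |u - v| ≤ |w - v| := hmin hmem
    apply hwz
    rcases mem_uIcc.1 hz with hz | hz <;> rcases mem_uIcc.1 hw with hw | hw <;>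
      rcases abs_cases (u - v) with hp | hp <;> rcases abs_cases (w - v) with hr | hr <;> linarith
  · by_contra! hlt
    obtain ⟨w, hw, hwd⟩ : d ∈ h '' uIcc u z :=
      intermediate_value_uIcc hc.continuousOn (mem_uIcc.2 (Or.inl ⟨huc ▸ hcd, hlt.le⟩))
    have hwz : w ≠ z := by rintro rfl; exact hlt.ne' hwd
    have hmem : (u, w) ∈ S :=
      ⟨⟨hu, hsub (uIcc_subset_uIcc left_mem_uIcc hz hw)⟩, huc, hwd⟩
    have hle : |u - v| ≤ |u - w| := hmin hmem
    apply hwz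
    rcases mem_uIcc.1 hz with hz | hz <;> rcases mem_uIcc.1 hw with hw | hw <;>
      rcases abs_cases (u - v) with hp | hp <;> rcases abs_cases (u - w) with hr | hr <;> linarith

/-- Along a chain of intervals, each covering the next one, some subinterval of the first follows
the chain and is mapped onto the last. -/
theorem exists_uIcc_follows_chain {f : ℝ → ℝ} (hf : Continuous f) (c d : ℕ → ℝ) (q : ℕ)
    (hcd : ∀ i ≤ q, c i ≤ d i)
    (hcov : ∀ i < q, c (i + 1) ∈ uIcc (f (c i)) (f (d i)) ∧ d (i + 1) ∈ uIcc (f (c i)) (f (d i))) :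
    ∃ u v, f^[q] u = c q ∧ f^[q] v = d q ∧
      ∀ z ∈ uIcc u v, ∀ i ≤ q, f^[i] z ∈ Icc (c i) (d i) := by
  induction q with
  | zero =>
    refine ⟨c 0, d 0, rfl, rfl, fun z hz i hi => ?_⟩
    obtain rfl : i = 0 := by omega
    rwa [uIcc_of_le (hcd 0 le_rfl)] at hz
  | succ q ih =>
    obtain ⟨u, v, hu, hv, hz⟩ := ih (fun i hi => hcd i (by omega)) (fun i hi => hcov i (by omega))
    have hcont : Continuous f^[q + 1] := hf.iterate _
    have hu' : f^[q + 1] u = f (c q) := by rw [Function.iterate_succ_apply', hu]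
    have hv' : f^[q + 1] v = f (d q) := by rw [Function.iterate_succ_apply', hv]
    have hq := hcov q (by omega)
    rw [← hu', ← hv'] at hq
    obtain ⟨x, hx, hxc⟩ := intermediate_value_uIcc hcont.continuousOn hq.1
    obtain ⟨y, hy, hyd⟩ := intermediate_value_uIcc hcont.continuousOn hq.2
    obtain ⟨u₁, v₁, hu₁, hv₁, huc, hvd, hmap⟩ :=
      exists_uIcc_mapsTo_Icc hcont (hcd (q + 1) le_rfl) hxc hyd
    refine ⟨u₁, v₁, huc, hvd, fun z hzm i hi => ?_⟩
    rcases Nat.lt_or_ge i (q + 1) with h | h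
    · exact hz z (uIcc_subset_uIcc hx hy (uIcc_subset_uIcc hu₁ hv₁ hzm)) i (by omega)
    · obtain rfl : i = q + 1 := by omega
      exact hmap z hzm

/-- A loop of intervals, each covering the next one, is followed by a point fixed by the iterate
whose order is the length of the loop. -/
theorem exists_iterate_fixed_of_loop {f : ℝ → ℝ} (hf : Continuous f) (c d : ℕ → ℝ) (q : ℕ)
    (hcd : ∀ i ≤ q, c i ≤ d i)
    (hcov : ∀ i < q, c (i + 1) ∈ uIcc (f (c i)) (f (d i)) ∧ d (i + 1) ∈ uIcc (f (c i)) (f (d i)))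
    (hc : c q = c 0) (hd : d q = d 0) :
    ∃ x, f^[q] x = x ∧ ∀ i ≤ q, f^[i] x ∈ Icc (c i) (d i) := by
  obtain ⟨u, v, hu, hv, hz⟩ := exists_uIcc_follows_chain hf c d q hcd hcov
  have hu0 := hz u left_mem_uIcc 0 (by omega)
  have hv0 := hz v right_mem_uIcc 0 (by omega)
  simp only [Function.iterate_zero, id] at hu0 hv0
  have hg : Continuous fun x => f^[q] x - x := (hf.iterate q).sub continuous_id
  obtain ⟨x, hx, hx0⟩ : (0 : ℝ) ∈ (fun x => f^[q] x - x) '' uIcc u v := by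
    refine intermediate_value_uIcc hg.continuousOn (mem_uIcc.2 (Or.inl ⟨?_, ?_⟩))
    · simp only [hu, hc]; linarith [hu0.1]
    · simp only [hv, hd]; linarith [hv0.2]
  exact ⟨x, by simpa [sub_eq_zero] using hx0, hz x hx⟩

/-- Under `σ`, the interval `[s, s + 1]` covers the interval `[t, t + 1]`. -/
def Covers (σ : ℕ → ℕ) (s t : ℕ) : Prop :=
  (σ s ≤ t ∧ t + 1 ≤ σ (s + 1)) ∨ (σ (s + 1) ≤ t ∧ t + 1 ≤ σ s)

/-- `p` is a loop of length `q`, not constant, among the intervals `[t, t + 1]`, `1 ≤ t ≤ m`. -/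
def IsCoverLoop (σ : ℕ → ℕ) (m q : ℕ) (p : ℕ → ℕ) : Prop :=
  (∀ i < q, (1 ≤ p i ∧ p i ≤ m) ∧ Covers σ (p i) (p (i + 1))) ∧ p q = p 0 ∧ ∃ i < q, p i ≠ p 0

/-- `σ` is a cyclic permutation of `{1, …, 2k+1}` whose covering graph has no nonconstant loop of
odd length strictly between `1` and `2k-1`. -/
structure IsCycleWithoutShortLoops (k : ℕ) (σ : ℕ → ℕ) : Prop where
  mapsTo : ∀ t, 1 ≤ t → t ≤ 2 * k + 1 → 1 ≤ σ t ∧ σ t ≤ 2 * k + 1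
  inj : ∀ s t, 1 ≤ s → s ≤ 2 * k + 1 → 1 ≤ t → t ≤ 2 * k + 1 → σ s = σ t → s = t
  trans : ∀ P : ℕ → Prop, (∀ t, 1 ≤ t → t ≤ 2 * k + 1 → P t → P (σ t)) →
    ∀ s, 1 ≤ s → s ≤ 2 * k + 1 → P s → ∀ t, 1 ≤ t → t ≤ 2 * k + 1 → P t
  noLoop : ∀ q, Odd q → 1 < q → q < 2 * k - 1 → ∀ p, ¬ IsCoverLoop σ (2 * k) q p

theorem IsOrbitWithPerm.iterate_eq {f : ℝ → ℝ} {m : ℕ} {β : ℕ → ℝ} {σ : ℕ → ℕ}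
    (h : IsOrbitWithPerm f m β σ) {t : ℕ} (ht : t ∈ Icc 1 m) (i : ℕ) :
    σ^[i] t ∈ Icc 1 m ∧ f^[i] (β t) = β (σ^[i] t) := by
  induction i with
  | zero => exact ⟨ht, rfl⟩
  | succ i ih =>
    rw [Function.iterate_succ_apply', Function.iterate_succ_apply', ih.2]
    exact ⟨h.2.2.1.mapsTo ih.1, h.2.2.2 _ ih.1⟩

theorem IsOrbitWithPerm.exists_iterate_eq {f : ℝ → ℝ} {m : ℕ} {β : ℕ → ℝ} {σ : ℕ → ℕ}
    (h : IsOrbitWithPerm f m β σ) {s t : ℕ} (hs : s ∈ Icc 1 m) (ht : t ∈ Icc 1 m) :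
    ∃ i, σ^[i] s = t := by
  have hne : ∀ i j, i < j → j < m → σ^[i] s ≠ σ^[j] s := by
    intro i j hij hj heq
    have hper := (h.2.1 _ (h.iterate_eq hs i).1).2 (j - i) (by omega) (by omega)
    apply hper
    rw [(h.iterate_eq (h.iterate_eq hs i).1 _).2, ← Function.iterate_add_apply,
      Nat.sub_add_cancel hij.le, heq]
  have hinj : Set.InjOn (fun i => σ^[i] s) (Finset.range m : Set ℕ) := by
    intro i hi j hj heq
    simp only [Finset.coe_range, mem_Iio] at hi hj
    rcases lt_trichotomy i j with hlt | hlt | hlt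
    · exact absurd heq (hne i j hlt hj)
    · exact hlt
    · exact absurd heq.symm (hne j i hlt hi)
  have himg : (Finset.range m).image (fun i => σ^[i] s) = Finset.Icc 1 m := by
    apply Finset.eq_of_subset_of_card_le
    · intro x hx
      obtain ⟨i, -, rfl⟩ := Finset.mem_image.1 hx
      exact Finset.mem_Icc.2 (h.iterate_eq hs i).1
    · rw [Finset.card_image_of_injOn hinj]; simp
  have : t ∈ (Finset.range m).image (fun i => σ^[i] s) := himg ▸ Finset.mem_Icc.2 ht
  obtain ⟨i, -, hi⟩ := Finset.mem_image.1 this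
  exact ⟨i, hi⟩

theorem IsOrbitWithPerm.not_isCoverLoop {f : ℝ → ℝ} (hf : Continuous f) {m : ℕ} (hm : 1 ≤ m)
    {β : ℕ → ℝ} {σ : ℕ → ℕ} (h : IsOrbitWithPerm f (m + 1) β σ) {q : ℕ} (hq : Odd q)
    (hno : ∀ r, Odd r → 1 < r → r ≤ q → ¬ ∃ y, PeriodicPtOfPeriod f r y ∧
      ∀ j : ℕ, f^[j] y ∈ Icc (β 1) (β (m + 1))) (p : ℕ → ℕ) :
    ¬ IsCoverLoop σ m q p := by
  rintro ⟨hp, hp0, i₀, hi₀, hne⟩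
  have hqpos : 0 < q := hq.pos
  have hmem : ∀ i ≤ q, 1 ≤ p i ∧ p i ≤ m := by
    intro i hi
    rcases hi.lt_or_eq with hi | rfl
    · exact (hp i hi).1
    · rw [hp0]; exact (hp 0 hqpos).1
  have hmono : ∀ s t, 1 ≤ s → s ≤ t → t ≤ m + 1 → β s ≤ β t := fun s t hs hst ht =>
    h.1.monotoneOn ⟨hs, hst.trans ht⟩ ⟨hs.trans hst, ht⟩ hst
  obtain ⟨x, hx, hxi⟩ := exists_iterate_fixed_of_loop hf (fun i => β (p i))
    (fun i => β (p i + 1)) q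
    (fun i hi => hmono _ _ (hmem i hi).1 (by omega) (by have := hmem i hi; omega))
    (fun i hi => by
      have hi1 := hmem i hi.le
      have hi2 := hmem (i + 1) hi
      have ha : p i ∈ Icc 1 (m + 1) := ⟨by omega, by omega⟩
      have hb : p i + 1 ∈ Icc 1 (m + 1) := ⟨by omega, by omega⟩
      have hsa := h.2.2.1.mapsTo ha
      have hsb := h.2.2.1.mapsTo hb
      simp only [h.2.2.2 _ ha, h.2.2.2 _ hb, mem_uIcc]
      simp only [mem_Icc] at hsa hsb
      rcases (hp i hi).2 with hc | hc
      · exact ⟨Or.inl ⟨hmono _ _ (by omega) (by omega) (by omega),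
          hmono _ _ (by omega) (by omega) (by omega)⟩,
          Or.inl ⟨hmono _ _ (by omega) (by omega) (by omega),
          hmono _ _ (by omega) (by omega) (by omega)⟩⟩
      · exact ⟨Or.inr ⟨hmono _ _ (by omega) (by omega) (by omega),
          hmono _ _ (by omega) (by omega) (by omega)⟩,
          Or.inr ⟨hmono _ _ (by omega) (by omega) (by omega),
          hmono _ _ (by omega) (by omega) (by omega)⟩⟩)
    (by simp [hp0]) (by simp [hp0])
  have hper : Function.IsPeriodicPt f q x := hx
  set r := Function.minimalPeriod f x with hr
  have hrpos : 0 < r := hper.minimalPeriod_pos hqpos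
  have hrdvd : r ∣ q := hper.minimalPeriod_dvd
  have hrodd : Odd r := hq.of_dvd_nat hrdvd
  have hr1 : r ≠ 1 := by
    intro hr1
    have hfix : f x = x := Function.minimalPeriod_eq_one_iff_isFixedPt.1 hr1
    have hfixi : ∀ i, f^[i] x = x := fun i => Function.iterate_fixed hfix i
    have h0 := hxi 0 (by omega)
    have h1 := hxi i₀ hi₀.le
    rw [hfixi] at h0 h1
    have key : ∀ s t, 1 ≤ s → s < t → t ≤ m → x ∈ Icc (β s) (β (s + 1)) →
        x ∈ Icc (β t) (β (t + 1)) → False := by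
      intro s t hs hst ht hxs hxt
      have hle := hmono (s + 1) t (by omega) hst (by omega)
      have hxeq : x = β t := le_antisymm (hxs.2.trans hle) hxt.1
      refine (h.2.1 t ⟨by omega, by omega⟩).2 1 le_rfl (by omega) ?_
      rw [← hxeq]; exact hfix
    rcases lt_or_gt_of_ne hne with hlt | hlt
    · exact key _ _ (hmem i₀ hi₀.le).1 hlt (hmem 0 (by omega)).2 h1 h0
    · exact key _ _ (hmem 0 (by omega)).1 hlt (hmem i₀ hi₀.le).2 h0 h1
  refine hno r hrodd (by omega) (Nat.le_of_dvd hqpos hrdvd) ⟨x, ⟨?_, ?_⟩, ?_⟩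
  · exact Function.isPeriodicPt_minimalPeriod f x
  · intro j hj hjr
    exact Function.not_isPeriodicPt_of_pos_of_lt_minimalPeriod (by omega) hjr
  · intro j
    have hlt := Nat.mod_lt j hqpos
    rw [← hper.iterate_mod_apply j]
    have hj := hxi (j % q) hlt.le
    have hj' := hmem (j % q) hlt.le
    exact ⟨(hmono _ _ le_rfl hj'.1 (by omega)).trans hj.1,
      hj.2.trans (hmono _ _ (by omega) (by omega) le_rfl)⟩

theorem SecondMinimalOrbit.isCycleWithoutShortLoops {k : ℕ} (hk : 1 ≤ k) {f : ℝ → ℝ}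
    (hf : Continuous f) {β : ℕ → ℝ} {σ : ℕ → ℕ} (horb : IsOrbitWithPerm f (2 * k + 1) β σ)
    (hsm : SecondMinimalOrbit f k β) : IsCycleWithoutShortLoops k σ where
  mapsTo t h1 h2 := horb.2.2.1.mapsTo ⟨h1, h2⟩
  inj s t hs hs' ht ht' h := horb.2.2.1.injOn ⟨hs, hs'⟩ ⟨ht, ht'⟩ h
  trans P hP s hs hs' hPs t ht ht' := by
    obtain ⟨i, rfl⟩ := horb.exists_iterate_eq ⟨hs, hs'⟩ ⟨ht, ht'⟩
    clear ht ht'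
    induction i with
    | zero => exact hPs
    | succ i ih =>
      rw [Function.iterate_succ_apply']
      have := (horb.iterate_eq (t := s) ⟨hs, hs'⟩ i).1
      exact hP _ this.1 this.2 ih
  noLoop q hq _ hq2 p :=
    horb.not_isCoverLoop hf (by omega) hq (fun r hr hr1 hrq => hsm.2 r hr hr1 (by omega)) p

theorem exists_not_and_succ {P : ℕ → Prop} {x y : ℕ} (hxy : x ≤ y) (hx : P x) (hy : ¬ P y) :
    ∃ t, x ≤ t ∧ t < y ∧ P t ∧ ¬ P (t + 1) := by
  by_contra! h
  apply hy
  induction y, hxy using Nat.le_induction with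
  | base => exact hx
  | succ n hn ih =>
    by_cases hP : P n
    · exact h n hn (by omega) hP
    · exact absurd (ih hP fun t h1 h2 => h t h1 (by omega)) hP

/-- `#{t ≤ a : σ t ≤ a} - #{t > a : σ t > a} = 2a - n` for a permutation `σ` of `{1, …, n}`. -/
theorem card_filter_le_add {n a : ℕ} {σ : ℕ → ℕ} (ha : a ≤ n)
    (hmap : ∀ t, 1 ≤ t → t ≤ n → 1 ≤ σ t ∧ σ t ≤ n)
    (hinj : ∀ s t, 1 ≤ s → s ≤ n → 1 ≤ t → t ≤ n → σ s = σ t → s = t) :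
    ((Finset.Icc 1 a).filter (fun t => σ t ≤ a)).card + n =
      2 * a + ((Finset.Icc (a + 1) n).filter (fun t => ¬ σ t ≤ a)).card := by
  have hinjOn : Set.InjOn σ (Finset.Icc 1 n : Finset ℕ) := by
    intro s hs t ht h
    simp only [Finset.coe_Icc, mem_Icc] at hs ht
    exact hinj s t hs.1 hs.2 ht.1 ht.2 h
  have himg : (Finset.Icc 1 n).image σ = Finset.Icc 1 n := by
    apply Finset.eq_of_subset_of_card_le
    · intro x hx
      obtain ⟨t, ht, rfl⟩ := Finset.mem_image.1 hx
      rw [Finset.mem_Icc] at ht ⊢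
      exact hmap t ht.1 ht.2
    · rw [Finset.card_image_of_injOn hinjOn]
  have hcard : ((Finset.Icc 1 n).filter (fun t => σ t ≤ a)).card = a := by
    rw [← Finset.card_image_of_injOn (hinjOn.mono (Finset.coe_subset.2 (Finset.filter_subset _ _))),
      ← Finset.filter_image (p := fun x => x ≤ a), himg]
    have : (Finset.Icc 1 n).filter (fun x => x ≤ a) = Finset.Icc 1 a := by
      ext x; simp only [Finset.mem_filter, Finset.mem_Icc]; omega
    rw [this]; simp
  have hunion : (Finset.Icc 1 n).filter (fun t => σ t ≤ a) =
      (Finset.Icc 1 a).filter (fun t => σ t ≤ a) ∪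
        (Finset.Icc (a + 1) n).filter (fun t => σ t ≤ a) := by
    ext x; simp only [Finset.mem_filter, Finset.mem_union, Finset.mem_Icc]; omega
  rw [hunion, Finset.card_union_of_disjoint] at hcard
  · have := Finset.card_filter_add_card_filter_not (s := Finset.Icc (a + 1) n) (fun t => σ t ≤ a)
    rw [Nat.card_Icc] at this
    omega
  · rw [Finset.disjoint_left]
    intro x; simp only [Finset.mem_filter, Finset.mem_Icc]; omega

namespace IsCycleWithoutShortLoops

variable {k : ℕ} {σ : ℕ → ℕ}

theorem apply_ne (h : IsCycleWithoutShortLoops k σ) (hk : 1 ≤ k) {t : ℕ} (h1 : 1 ≤ t)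
    (h2 : t ≤ 2 * k + 1) : σ t ≠ t := by
  intro heq
  have key := h.trans (fun s => s = t) (by rintro s - - rfl; exact heq) t h1 h2 rfl
  have e1 := key 1 (by omega) (by omega)
  have e2 := key 2 (by omega) (by omega)
  omega

theorem Icc_full (h : IsCycleWithoutShortLoops k σ) {l r : ℕ} (h1 : 1 ≤ l) (hlr : l ≤ r)
    (hr : r ≤ 2 * k + 1) (hinv : ∀ x, l ≤ x → x ≤ r → l ≤ σ x ∧ σ x ≤ r) :
    l = 1 ∧ r = 2 * k + 1 := by
  have key := h.trans (fun x => l ≤ x ∧ x ≤ r) (fun x _ _ hx => hinv x hx.1 hx.2) l h1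
    (by omega) ⟨le_rfl, hlr⟩
  have e1 := key 1 (by omega) (by omega)
  have e2 := key (2 * k + 1) (by omega) (by omega)
  omega

theorem reflect (h : IsCycleWithoutShortLoops k σ) :
    IsCycleWithoutShortLoops k (fun t => 2 * k + 2 - σ (2 * k + 2 - t)) where
  mapsTo t h1 h2 := by
    have := h.mapsTo (2 * k + 2 - t) (by omega) (by omega)
    omega
  inj s t hs hs' ht ht' heq := by
    have e1 := h.mapsTo (2 * k + 2 - s) (by omega) (by omega)
    have e2 := h.mapsTo (2 * k + 2 - t) (by omega) (by omega)
    have := h.inj (2 * k + 2 - s) (2 * k + 2 - t) (by omega) (by omega) (by omega) (by omega)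
      (by omega)
    omega
  trans P hP s hs hs' hPs t ht ht' := by
    have key := h.trans (fun x => P (2 * k + 2 - x))
      (fun x h1 h2 hx => by
        have := hP (2 * k + 2 - x) (by omega) (by omega) hx
        rwa [show 2 * k + 2 - (2 * k + 2 - x) = x by omega] at this)
      (2 * k + 2 - s) (by omega) (by omega)
      (by rwa [show 2 * k + 2 - (2 * k + 2 - s) = s by omega])
      (2 * k + 2 - t) (by omega) (by omega)
    rwa [show 2 * k + 2 - (2 * k + 2 - t) = t by omega] at key
  noLoop q hq hq1 hq2 p := by
    rintro ⟨hp, hp0, i, hi, hne⟩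
    have hmem : ∀ i ≤ q, 1 ≤ p i ∧ p i ≤ 2 * k := by
      intro i hi
      rcases hi.lt_or_eq with hi | rfl
      · exact (hp i hi).1
      · rw [hp0]; exact (hp 0 (by omega)).1
    refine h.noLoop q hq hq1 hq2 (fun i => 2 * k + 1 - p i) ⟨fun i hi => ⟨?_, ?_⟩, ?_, i, hi, ?_⟩
    · have := hmem i hi.le
      beta_reduce
      omega
    · have h1 := hmem i hi.le
      have h2 := hmem (i + 1) hi
      have hc := (hp i hi).2
      have e1 := h.mapsTo (2 * k + 1 - p i) (by omega) (by omega)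
      have e2 := h.mapsTo (2 * k + 1 - p i + 1) (by omega) (by omega)
      unfold Covers at hc ⊢
      beta_reduce
      simp only [show 2 * k + 2 - p i = 2 * k + 1 - p i + 1 by omega,
        show 2 * k + 2 - (p i + 1) = 2 * k + 1 - p i by omega] at hc
      omega
    · simp only [hp0]
    · have h1 := hmem i hi.le
      have h2 := hmem 0 (by omega)
      simp only
      omega

theorem simplePos (h : IsCycleWithoutShortLoops k σ)
    (hr : ∀ t, k + 2 ≤ t → t ≤ 2 * k + 1 → σ t ≤ k + 1) : SimplePos k σ := by
  refine ⟨fun t ht => ⟨(h.mapsTo t (by have := ht.1; omega) ht.2).1, hr t ht.1 ht.2⟩, ?_⟩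
  have hcard := card_filter_le_add (a := k + 1) (by omega) h.mapsTo h.inj
  rw [Finset.filter_false_of_mem (s := Finset.Icc (k + 1 + 1) (2 * k + 1))
    (fun t ht => not_not.2 (hr t (Finset.mem_Icc.1 ht).1 (Finset.mem_Icc.1 ht).2)),
    Finset.card_empty] at hcard
  obtain ⟨p, hp⟩ := Finset.card_eq_one.1
    (show ((Finset.Icc 1 (k + 1)).filter (fun t => σ t ≤ k + 1)).card = 1 by omega)
  have hiff : ∀ t, t ∈ Icc 1 (k + 1) ∧ σ t ∈ Icc 1 (k + 1) ↔ t = p := by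
    intro t
    rw [← Finset.mem_singleton, ← hp, Finset.mem_filter, Finset.mem_Icc, mem_Icc, mem_Icc]
    exact ⟨fun ht => ⟨ht.1, ht.2.2⟩,
      fun ht => ⟨ht.1, (h.mapsTo t ht.1.1 (by have := ht.1.2; omega)).1, ht.2⟩⟩
  exact ⟨p, (hiff p).2 rfl, fun y hy => (hiff y).1 hy⟩

theorem simpleNeg (h : IsCycleWithoutShortLoops k σ)
    (hl : ∀ t, 1 ≤ t → t ≤ k → k + 1 ≤ σ t) : SimpleNeg k σ := by
  refine ⟨fun t ht => ⟨hl t ht.1 ht.2, (h.mapsTo t ht.1 (by have := ht.2; omega)).2⟩, ?_⟩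
  have hcard := card_filter_le_add (a := k) (by omega) h.mapsTo h.inj
  rw [Finset.filter_false_of_mem (s := Finset.Icc 1 k)
    (fun t ht => by have := hl t (Finset.mem_Icc.1 ht).1 (Finset.mem_Icc.1 ht).2; omega),
    Finset.card_empty] at hcard
  obtain ⟨p, hp⟩ := Finset.card_eq_one.1
    (show ((Finset.Icc (k + 1) (2 * k + 1)).filter (fun t => ¬ σ t ≤ k)).card = 1 by omega)
  have hiff : ∀ t, t ∈ Icc (k + 1) (2 * k + 1) ∧ σ t ∈ Icc (k + 1) (2 * k + 1) ↔ t = p := by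
    intro t
    rw [← Finset.mem_singleton, ← hp, Finset.mem_filter, Finset.mem_Icc, mem_Icc, mem_Icc]
    exact ⟨fun ht => ⟨ht.1, by have := ht.2.1; omega⟩,
      fun ht => ⟨ht.1, by have := ht.2; omega, (h.mapsTo t (by omega) ht.1.2).2⟩⟩
  exact ⟨p, (hiff p).2 rfl, fun y hy => (hiff y).1 hy⟩

end IsCycleWithoutShortLoops

/-- `[lo j, hi j]` is the hull of the image of `[lo (j - 1), hi (j - 1)]` under `σ`, starting from
`[a, a + 1]`. -/
structure IsHullSeq (σ : ℕ → ℕ) (a : ℕ) (lo hi : ℕ → ℕ) : Prop where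
  lo_zero : lo 0 = a
  hi_zero : hi 0 = a + 1
  le_apply : ∀ j x, lo j ≤ x → x ≤ hi j → lo (j + 1) ≤ σ x
  apply_le : ∀ j x, lo j ≤ x → x ≤ hi j → σ x ≤ hi (j + 1)
  exists_lo : ∀ j, ∃ x, lo j ≤ x ∧ x ≤ hi j ∧ σ x = lo (j + 1)
  exists_hi : ∀ j, ∃ x, lo j ≤ x ∧ x ≤ hi j ∧ σ x = hi (j + 1)

theorem exists_isHullSeq (σ : ℕ → ℕ) (a : ℕ) : ∃ lo hi, IsHullSeq σ a lo hi := by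
  have step : ∀ w : {w : ℕ × ℕ // w.1 ≤ w.2}, ∃ w' : {w : ℕ × ℕ // w.1 ≤ w.2},
      (∀ x, w.1.1 ≤ x → x ≤ w.1.2 → w'.1.1 ≤ σ x ∧ σ x ≤ w'.1.2) ∧
      (∃ x, w.1.1 ≤ x ∧ x ≤ w.1.2 ∧ σ x = w'.1.1) ∧
      (∃ x, w.1.1 ≤ x ∧ x ≤ w.1.2 ∧ σ x = w'.1.2) := by
    rintro ⟨⟨l, h⟩, hlh⟩
    have hne : (Finset.Icc l h).Nonempty := Finset.nonempty_Icc.2 hlh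
    obtain ⟨x, hx, hxmin⟩ := Finset.exists_min_image _ σ hne
    obtain ⟨y, hy, hymax⟩ := Finset.exists_max_image _ σ hne
    simp only [Finset.mem_Icc] at hx hy hxmin hymax
    exact ⟨⟨⟨σ x, σ y⟩, hxmin y hy⟩, fun z h1 h2 => ⟨hxmin z ⟨h1, h2⟩, hymax z ⟨h1, h2⟩⟩,
      ⟨x, hx.1, hx.2, rfl⟩, ⟨y, hy.1, hy.2, rfl⟩⟩
  choose next hnext using step
  let w : ℕ → {w : ℕ × ℕ // w.1 ≤ w.2} := fun j => Nat.rec ⟨(a, a + 1), by simp⟩ (fun _ => next) j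
  exact ⟨fun j => (w j).1.1, fun j => (w j).1.2, rfl, rfl,
    fun j x h1 h2 => ((hnext (w j)).1 x h1 h2).1, fun j x h1 h2 => ((hnext (w j)).1 x h1 h2).2,
    fun j => (hnext (w j)).2.1, fun j => (hnext (w j)).2.2⟩

namespace IsHullSeq

variable {k a : ℕ} {σ lo hi : ℕ → ℕ}

theorem monotone (hs : IsHullSeq σ a lo hi) (hr : a + 1 ≤ σ a) (hl : σ (a + 1) ≤ a) (j : ℕ) :
    lo j ≤ a ∧ a + 1 ≤ hi j ∧ lo (j + 1) ≤ lo j ∧ hi j ≤ hi (j + 1) := by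
  induction j with
  | zero =>
    have h1 := hs.lo_zero
    have h2 := hs.hi_zero
    have h3 := hs.le_apply 0 (a + 1) (by omega) (by omega)
    have h4 := hs.apply_le 0 a (by omega) (by omega)
    omega
  | succ j ih =>
    obtain ⟨x, hx, hx', hxe⟩ := hs.exists_lo j
    obtain ⟨y, hy, hy', hye⟩ := hs.exists_hi j
    have h3 := hs.le_apply (j + 1) x (by omega) (by omega)
    have h4 := hs.apply_le (j + 1) y (by omega) (by omega)
    omega

theorem bounds (hs : IsHullSeq σ a lo hi) {n : ℕ} (h1 : 1 ≤ a) (h2 : a + 1 ≤ n)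
    (hmap : ∀ t, 1 ≤ t → t ≤ n → 1 ≤ σ t ∧ σ t ≤ n) (j : ℕ) : 1 ≤ lo j ∧ hi j ≤ n := by
  induction j with
  | zero => rw [hs.lo_zero, hs.hi_zero]; exact ⟨h1, h2⟩
  | succ j ih =>
    obtain ⟨x, hx, hx', hxe⟩ := hs.exists_lo j
    obtain ⟨y, hy, hy', hye⟩ := hs.exists_hi j
    rw [← hxe, ← hye]
    exact ⟨(hmap x (by omega) (by omega)).1, (hmap y (by omega) (by omega)).2⟩

theorem exists_covers (hs : IsHullSeq σ a lo hi) {j t : ℕ} (h1 : lo (j + 1) ≤ t)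
    (h2 : t < hi (j + 1)) : ∃ s, lo j ≤ s ∧ s < hi j ∧ Covers σ s t := by
  obtain ⟨x, hx, hx', hxe⟩ := hs.exists_lo j
  obtain ⟨y, hy, hy', hye⟩ := hs.exists_hi j
  rcases Nat.le_total x y with hxy | hxy
  · obtain ⟨s, hs1, hs2, hs3, hs4⟩ := exists_not_and_succ (P := fun z => σ z ≤ t) hxy
      (by omega) (by omega)
    exact ⟨s, by omega, by omega, Or.inl ⟨hs3, by omega⟩⟩
  · obtain ⟨s, hs1, hs2, hs3, hs4⟩ := exists_not_and_succ (P := fun z => ¬ σ z ≤ t) hxy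
      (by omega) (by omega)
    exact ⟨s, by omega, by omega, Or.inr ⟨by omega, by omega⟩⟩

theorem exists_path (hs : IsHullSeq σ a lo hi) {n : ℕ} (hb : ∀ j, 1 ≤ lo j ∧ hi j ≤ n + 1)
    (j t : ℕ) (h1 : lo j ≤ t) (h2 : t < hi j) :
    ∃ p : ℕ → ℕ, p 0 = a ∧ p j = t ∧
      ∀ i < j, (1 ≤ p i ∧ p i ≤ n) ∧ Covers σ (p i) (p (i + 1)) := by
  induction j generalizing t with
  | zero =>
    rw [hs.lo_zero] at h1
    rw [hs.hi_zero] at h2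
    exact ⟨fun _ => a, rfl, by beta_reduce; omega, fun i hi => absurd hi (by omega)⟩
  | succ j ih =>
    obtain ⟨s, hs1, hs2, hst⟩ := hs.exists_covers h1 h2
    obtain ⟨p, hp0, hpj, hp⟩ := ih s hs1 hs2
    refine ⟨fun i => if i ≤ j then p i else t, by simpa using hp0, by simp, fun i hi => ?_⟩
    rcases Nat.lt_or_ge i j with hij | hij
    · simp only [hij.le, if_true, show i + 1 ≤ j from hij]
      exact hp i hij
    · obtain rfl : i = j := by omega
      have := hb i
      simp only [le_refl, if_true, show ¬ i + 1 ≤ i by omega, if_false, hpj]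
      exact ⟨by omega, hst⟩

/-- Within `2k - 4` steps the hulls only reach points which `σ` moves to the other side. -/
theorem switches (hs : IsHullSeq σ a lo hi) (h : IsCycleWithoutShortLoops k σ) (hk : 3 ≤ k)
    (hb : ∀ j, 1 ≤ lo j ∧ hi j ≤ 2 * k + 1) (hr : a + 1 ≤ σ a) (hl : σ (a + 1) ≤ a) :
    (∀ x, lo (2 * k - 4) ≤ x → x ≤ a → a + 1 ≤ σ x) ∧
      (∀ x, a + 1 ≤ x → x ≤ hi (2 * k - 4) → σ x ≤ a) := by
  have hm := hs.monotone hr hl (2 * k - 4)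
  have noCover : ∀ t, lo (2 * k - 4) ≤ t → t < hi (2 * k - 4) → t ≠ a → ¬ Covers σ t a := by
    intro t h1 h2 hne hcov
    obtain ⟨p, hp0, hpt, hp⟩ := hs.exists_path hb _ t h1 h2
    refine h.noLoop (2 * k - 3) ⟨k - 2, by omega⟩ (by omega) (by omega)
      (fun i => if i ≤ 2 * k - 4 then p i else a) ⟨fun i hi => ?_, ?_, 2 * k - 4, by omega, ?_⟩
    · rcases Nat.lt_or_ge i (2 * k - 4) with hi | hi
      · simp only [hi.le, if_true, show i + 1 ≤ 2 * k - 4 from hi]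
        exact hp i hi
      · obtain rfl : i = 2 * k - 4 := by omega
        have := hb (2 * k - 4)
        simp only [le_refl, if_true, show ¬ 2 * k - 4 + 1 ≤ 2 * k - 4 by omega, if_false, hpt]
        exact ⟨by omega, hcov⟩
    · simp only [show ¬ 2 * k - 3 ≤ 2 * k - 4 by omega, if_false, Nat.zero_le, if_true, hp0]
    · simpa [hpt, hp0] using hne
  constructor
  · intro x h1 h2
    by_contra hx
    obtain ⟨t, ht1, ht2, ht3, ht4⟩ := exists_not_and_succ (P := fun z => σ z ≤ a) h2
      (by omega) (by omega)
    exact noCover t (by omega) (by omega) (by omega) (Or.inl ⟨ht3, by omega⟩)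
  · intro x h1 h2
    by_contra hx
    obtain ⟨t, ht1, ht2, ht3, ht4⟩ := exists_not_and_succ (P := fun z => σ z ≤ a) h1
      (by omega) hx
    exact noCover t (by omega) (by omega) (by omega) (Or.inl ⟨ht3, by omega⟩)

theorem antitone_lo (hs : IsHullSeq σ a lo hi) (hr : a + 1 ≤ σ a) (hl : σ (a + 1) ≤ a) :
    Antitone lo :=
  antitone_nat_of_succ_le fun j => (hs.monotone hr hl j).2.2.1

theorem monotone_hi (hs : IsHullSeq σ a lo hi) (hr : a + 1 ≤ σ a) (hl : σ (a + 1) ≤ a) :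
    Monotone hi :=
  monotone_nat_of_le_succ fun j => (hs.monotone hr hl j).2.2.2

/-- During the first `2k - 4` steps the hulls grow strictly. -/
theorem grows (hs : IsHullSeq σ a lo hi) (h : IsCycleWithoutShortLoops k σ) (hk : 3 ≤ k)
    (hb : ∀ j, 1 ≤ lo j ∧ hi j ≤ 2 * k + 1) (hr : a + 1 ≤ σ a) (hl : σ (a + 1) ≤ a)
    (j d : ℕ) (hj : j + d ≤ 2 * k - 4) :
    hi j + lo (j + d) + d ≤ hi (j + d) + lo j := by
  induction d with
  | zero => simp
  | succ d ih =>
    specialize ih (by omega)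
    have hm := hs.monotone hr hl (j + d)
    by_contra hcon
    rw [show j + (d + 1) = j + d + 1 by omega] at hcon
    have hsw := hs.switches h hk hb hr hl
    have hlo := hs.antitone_lo hr hl (show j + d ≤ 2 * k - 4 by omega)
    have hhi := hs.monotone_hi hr hl (show j + d ≤ 2 * k - 4 by omega)
    have hfull := h.Icc_full (l := lo (j + d)) (r := hi (j + d)) (hb _).1 (by omega) (hb _).2
      (fun x h1 h2 => by
        have h3 := hs.le_apply _ x h1 h2
        have h4 := hs.apply_le _ x h1 h2
        omega)
    have hcard := card_filter_le_add (a := a) (by omega) h.mapsTo h.inj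
    rw [Finset.filter_false_of_mem (s := Finset.Icc 1 a) (fun t ht => by
        have := hsw.1 t (by rw [Finset.mem_Icc] at ht; omega) (Finset.mem_Icc.1 ht).2
        omega),
      Finset.filter_false_of_mem (s := Finset.Icc (a + 1) (2 * k + 1)) (fun t ht => by
        have := hsw.2 t (Finset.mem_Icc.1 ht).1 (by rw [Finset.mem_Icc] at ht; omega)
        omega)] at hcard
    simp only [Finset.card_empty] at hcard
    omega

/-- Either few points stay on their side of the gap `(a, a + 1)`, or the hulls grow by a single
point at each step and all the points they miss stay on their side. -/
theorem simple_or_slow (hs : IsHullSeq σ a lo hi) (h : IsCycleWithoutShortLoops k σ) (hk : 3 ≤ k)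
    (hb : ∀ j, 1 ≤ lo j ∧ hi j ≤ 2 * k + 1) (hr : a + 1 ≤ σ a) (hl : σ (a + 1) ≤ a) :
    (∀ t, k + 2 ≤ t → t ≤ 2 * k + 1 → σ t ≤ k + 1) ∨ (∀ t, 1 ≤ t → t ≤ k → k + 1 ≤ σ t) ∨
      (hi (2 * k - 4) + 3 = lo (2 * k - 4) + 2 * k ∧
        (∀ t, 1 ≤ t → t < lo (2 * k - 4) → σ t ≤ a) ∧
        (∀ t, hi (2 * k - 4) < t → t ≤ 2 * k + 1 → a < σ t)) := by
  have hsw := hs.switches h hk hb hr hl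
  have hg := hs.grows h hk hb hr hl 0 (2 * k - 4) (by omega)
  have hm := hs.monotone hr hl (2 * k - 4)
  have hb' := hb (2 * k - 4)
  rw [Nat.zero_add, hs.lo_zero, hs.hi_zero] at hg
  set l := lo (2 * k - 4)
  set r := hi (2 * k - 4)
  have hcard := card_filter_le_add (a := a) (n := 2 * k + 1) (by omega) h.mapsTo h.inj
  set S := (Finset.Icc 1 a).filter (fun t => σ t ≤ a) with hS
  set U := (Finset.Icc (a + 1) (2 * k + 1)).filter (fun t => ¬ σ t ≤ a) with hU
  have hSsub : S ⊆ Finset.Icc 1 (l - 1) := by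
    intro x hx
    rw [hS, Finset.mem_filter, Finset.mem_Icc] at hx
    rw [Finset.mem_Icc]
    by_contra hcon
    have := hsw.1 x (by omega) (by omega)
    omega
  have hUsub : U ⊆ Finset.Icc (r + 1) (2 * k + 1) := by
    intro x hx
    rw [hU, Finset.mem_filter, Finset.mem_Icc] at hx
    rw [Finset.mem_Icc]
    by_contra hcon
    have := hsw.2 x (by omega) (by omega)
    omega
  have hScard := Finset.card_le_card hSsub
  have hUcard := Finset.card_le_card hUsub
  rw [Nat.card_Icc] at hScard hUcard
  by_cases hpos : U.card = 0 ∧ a = k + 1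
  · left
    intro t h1 h2
    by_contra hcon
    have : t ∈ U := by rw [hU, Finset.mem_filter, Finset.mem_Icc]; omega
    rw [Finset.card_eq_zero.1 hpos.1] at this
    simp at this
  by_cases hneg : S.card = 0 ∧ a = k
  · right; left
    intro t h1 h2
    by_contra hcon
    have : t ∈ S := by rw [hS, Finset.mem_filter, Finset.mem_Icc]; omega
    rw [Finset.card_eq_zero.1 hneg.1] at this
    simp at this
  right; right
  have hSeq := Finset.eq_of_subset_of_card_le hSsub (by rw [Nat.card_Icc]; omega)
  have hUeq := Finset.eq_of_subset_of_card_le hUsub (by rw [Nat.card_Icc]; omega)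
  refine ⟨by omega, fun t h1 h2 => ?_, fun t h1 h2 => ?_⟩
  · have : t ∈ S := by rw [hSeq, Finset.mem_Icc]; omega
    exact (Finset.mem_filter.1 this).2
  · have : t ∈ U := by rw [hUeq, Finset.mem_Icc]; omega
    exact not_le.1 (Finset.mem_filter.1 this).2

/-- When the hulls grow by a single point at each step, `σ` spirals outwards. -/
theorem spiral (hs : IsHullSeq σ a lo hi) (h : IsCycleWithoutShortLoops k σ) (hk : 3 ≤ k)
    (hb : ∀ j, 1 ≤ lo j ∧ hi j ≤ 2 * k + 1) (hr : a + 2 ≤ σ a) (hl : σ (a + 1) ≤ a)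
    (hslow : hi (2 * k - 4) + 3 = lo (2 * k - 4) + 2 * k) (i : ℕ) (hik : i + 2 ≤ k) :
    lo (2 * i) + i = a ∧ hi (2 * i) = a + 1 + i ∧ (∀ j ≤ i, σ (a + 1 + j) + j = a) ∧
      ∀ j < i, σ (a - j) = a + 2 + j := by
  have hsw := hs.switches h hk hb (by omega) hl
  have hmono := hs.monotone (by omega) hl
  have hexact : ∀ j ≤ 2 * k - 4, hi j = lo j + j + 1 := by
    intro j hj
    have h1 := hs.grows h hk hb (by omega) hl 0 j (by omega)
    have h2 := hs.grows h hk hb (by omega) hl j (2 * k - 4 - j) (by omega)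
    rw [Nat.zero_add, hs.lo_zero, hs.hi_zero] at h1
    rw [show j + (2 * k - 4 - j) = 2 * k - 4 by omega] at h2
    omega
  have hlo : ∀ j ≤ 2 * k - 4, ∃ x, a + 1 ≤ x ∧ x ≤ hi j ∧ σ x = lo (j + 1) := by
    intro j hj
    obtain ⟨x, hx, hx', hxe⟩ := hs.exists_lo j
    refine ⟨x, ?_, hx', hxe⟩
    by_contra hcon
    have h1 := hs.antitone_lo (by omega) hl hj
    have h2 := hsw.1 x (by omega) (by omega)
    have := hmono (j + 1)
    omega
  have hhi : ∀ j ≤ 2 * k - 4, ∃ x, lo j ≤ x ∧ x ≤ a ∧ σ x = hi (j + 1) := by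
    intro j hj
    obtain ⟨x, hx, hx', hxe⟩ := hs.exists_hi j
    refine ⟨x, hx, ?_, hxe⟩
    by_contra hcon
    have h1 := hs.monotone_hi (by omega) hl hj
    have h2 := hsw.2 x (by omega) (by omega)
    have := hmono (j + 1)
    omega
  induction i with
  | zero =>
    refine ⟨by simp [hs.lo_zero], by simp [hs.hi_zero], ?_, by simp⟩
    intro j hj
    obtain rfl : j = 0 := by omega
    have h1 := hexact 1 (by omega)
    have h2 := hs.apply_le 0 a hs.lo_zero.le (by rw [hs.hi_zero]; omega)
    have h3 := hs.le_apply 0 (a + 1) (by rw [hs.lo_zero]; omega) hs.hi_zero.ge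
    have := hmono 1
    simp only [Nat.zero_add, Nat.add_zero] at *
    omega
  | succ i ih =>
    obtain ⟨hlo0, hhi0, hR, hL⟩ := ih (by omega)
    have hlo1 : lo (2 * i + 1) + i = a := by
      obtain ⟨x, hx, hx', hxe⟩ := hlo (2 * i) (by omega)
      have h1 := hR (x - (a + 1)) (by omega)
      rw [show a + 1 + (x - (a + 1)) = x by omega] at h1
      have := hmono (2 * i)
      omega
    have hhi1 : hi (2 * i + 1) = a + 2 + i := by
      have := hexact (2 * i + 1) (by omega)
      omega
    have hL' : ∀ j < i + 1, σ (a - j) = a + 2 + j := by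
      intro j hj
      rcases Nat.lt_or_ge j i with hji | hji
      · exact hL j hji
      obtain rfl : j = i := by omega
      obtain ⟨x, hx, hx', hxe⟩ := hhi (2 * j) (by omega)
      by_cases hxj : x = a - j
      · rw [← hxj, hxe, hhi1]
      · have h1 := hL (a - x) (by omega)
        rw [show a - (a - x) = x by omega] at h1
        omega
    have hhi2 : hi (2 * i + 1 + 1) = a + 2 + i := by
      obtain ⟨x, hx, hx', hxe⟩ := hhi (2 * i + 1) (by omega)
      have h1 := hL' (a - x) (by omega)
      rw [show a - (a - x) = x by omega] at h1
      have := hmono (2 * i + 1)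
      omega
    have hlo2 : lo (2 * i + 1 + 1) + (i + 1) = a := by
      have := hexact (2 * i + 1 + 1) (by omega)
      omega
    refine ⟨hlo2, by rw [show 2 * (i + 1) = 2 * i + 1 + 1 by omega, hhi2]; omega, ?_, hL'⟩
    intro j hj
    rcases Nat.lt_or_ge j (i + 1) with hji | hji
    · exact hR j (by omega)
    obtain rfl : j = i + 1 := by omega
    obtain ⟨x, hx, hx', hxe⟩ := hlo (2 * i + 1) (by omega)
    by_cases hxj : x = a + 1 + (i + 1)
    · rw [← hxj, hxe, hlo2]
    · have h1 := hR (x - (a + 1)) (by omega)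
      rw [show a + 1 + (x - (a + 1)) = x by omega] at h1
      omega

end IsHullSeq

namespace IsCycleWithoutShortLoops

variable {k a : ℕ} {σ : ℕ → ℕ}

theorem not_covers_triangle (h : IsCycleWithoutShortLoops k σ) (hk : 3 ≤ k) {x y z : ℕ}
    (hx : 1 ≤ x ∧ x ≤ 2 * k) (hy : 1 ≤ y ∧ y ≤ 2 * k) (hz : 1 ≤ z ∧ z ≤ 2 * k) (hne : y ≠ x)
    (hxy : Covers σ x y) (hyz : Covers σ y z) (hzx : Covers σ z x) : False := by
  refine h.noLoop 3 (by decide) (by omega) (by omega)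
    (fun i => if i = 1 then y else if i = 2 then z else x)
    ⟨fun i hi => ?_, by simp, 1, by omega, by simpa using hne⟩
  interval_cases i
  · exact ⟨by simpa using hx, by simpa using hxy⟩
  · exact ⟨by simpa using hy, by simpa using hyz⟩
  · exact ⟨by simpa using hz, by simpa using hzx⟩

theorem simple_of_add_two_le (h : IsCycleWithoutShortLoops k σ) (hk : 3 ≤ k) (h1 : 1 ≤ a)
    (h2 : a ≤ 2 * k) (hr : a + 2 ≤ σ a) (hl : σ (a + 1) ≤ a) :
    (∀ t, k + 2 ≤ t → t ≤ 2 * k + 1 → σ t ≤ k + 1) ∨ (∀ t, 1 ≤ t → t ≤ k → k + 1 ≤ σ t) := by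
  obtain ⟨lo, hi, hs⟩ := exists_isHullSeq σ a
  have hb := hs.bounds (n := 2 * k + 1) h1 (by omega) h.mapsTo
  rcases hs.simple_or_slow h hk hb (by omega) hl with hpos | hneg | ⟨hslow, houtL, houtR⟩
  · exact Or.inl hpos
  · exact Or.inr hneg
  exfalso
  obtain ⟨hlo, hhi, hR, hL⟩ := hs.spiral h hk hb hr hl hslow (k - 2) (by omega)
  have hsw := hs.switches h hk hb (by omega) hl
  have hb' := hb (2 * k - 4)
  rw [show 2 * (k - 2) = 2 * k - 4 by omega] at hlo hhi
  set l := lo (2 * k - 4)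
  set r := hi (2 * k - 4)
  have hleft : ∀ x, l < x → x ≤ a → σ x + x = 2 * a + 2 := by
    intro x hx hx'
    have := hL (a - x) (by omega)
    rw [show a - (a - x) = x by omega] at this
    omega
  have hright : ∀ x, a + 1 ≤ x → x ≤ r → σ x + x = 2 * a + 1 := by
    intro x hx hx'
    have := hR (x - (a + 1)) (by omega)
    rw [show a + 1 + (x - (a + 1)) = x by omega] at this
    omega
  have hσl : r < σ l := by
    by_contra hcon
    have := h.Icc_full (l := l) (r := r) (by omega) (by omega) (by omega) (fun x hx hx' => by
      rcases Nat.lt_or_ge a x with hxa | hxa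
      · have := hright x hxa hx'
        omega
      · rcases hx.lt_or_eq with hxl | rfl
        · have := hleft x hxl hxa
          omega
        · have := hsw.1 _ hx hxa
          omega)
    omega
  have hσl' := h.mapsTo l (by omega) (by omega)
  have ha : a = k - 1 := by
    by_contra ha
    have := h.Icc_full (l := l) (r := 2 * k + 1) (by omega) (by omega) (by omega)
      (fun x hx hx' => by
        have hx1 := h.mapsTo x (by omega) (by omega)
        rcases Nat.lt_or_ge a x with hxa | hxa
        · rcases Nat.lt_or_ge r x with hxr | hxr
          · have := houtR x hxr hx'
            omega
          · have := hright x hxa hxr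
            omega
        · have := hsw.1 _ hx hxa
          omega)
    omega
  have hl1 : l = 1 := by omega
  have hr1 : r = 2 * k - 2 := by omega
  rw [hl1] at hσl
  have e2 := hleft 2 (by omega) (by omega)
  have e3 := hright (2 * k - 2) (by omega) (by omega)
  have hout : ∀ t, 2 * k - 1 ≤ t → t ≤ 2 * k + 1 → σ t = k ∨ 2 * k - 1 ≤ σ t := by
    intro t ht ht'
    by_contra! hcon
    have h3 := houtR t (by omega) ht'
    have h4 := hleft (2 * k - σ t) (by omega) (by omega)
    have := h.inj t (2 * k - σ t) (by omega) (by omega) (by omega) (by omega) (by omega)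
    omega
  have hne := h.apply_ne (by omega) (t := 2 * k - 1) (by omega) (by omega)
  rcases hout (2 * k - 1) le_rfl (by omega) with hk1 | hk1
  · have hσ1 : σ 1 ≠ 2 * k - 1 := by
      intro heq
      have := h.Icc_full (l := 1) (r := 2 * k - 1) le_rfl (by omega) (by omega)
        (fun x hx hx' => by
          have hx1 := h.mapsTo x (by omega) (by omega)
          refine ⟨hx1.1, ?_⟩
          rcases Nat.lt_or_ge a x with hxa | hxa
          · rcases Nat.lt_or_ge r x with hxr | hxr
            · obtain rfl : x = 2 * k - 1 := by omega
              omega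
            · have := hright x hxa hxr
              omega
          · rcases hx.lt_or_eq with hxl | rfl
            · have := hleft x (by omega) hxa
              omega
            · omega)
      omega
    have hσ2k : 2 * k - 1 ≤ σ (2 * k) := by
      rcases hout (2 * k) (by omega) (by omega) with hk2 | hk2
      · have := h.inj (2 * k - 1) (2 * k) (by omega) (by omega) (by omega) (by omega) (by omega)
        omega
      · exact hk2
    refine h.not_covers_triangle hk (x := 1) (y := 2 * k - 1) (z := 2 * k - 2) (by omega)
      (by omega) (by omega) (by omega) (Or.inr ⟨?_, ?_⟩) (Or.inl ⟨?_, ?_⟩) (Or.inl ⟨?_, ?_⟩)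
    · rw [one_add_one_eq_two]; omega
    · omega
    · omega
    · rw [show 2 * k - 1 + 1 = 2 * k by omega]; omega
    · omega
    · rw [show 2 * k - 2 + 1 = 2 * k - 1 by omega]; omega
  · refine h.not_covers_triangle hk (x := 1) (y := 2 * k - 2) (z := 2 * k - 2) (by omega)
      (by omega) (by omega) (by omega) (Or.inr ⟨?_, ?_⟩) (Or.inl ⟨?_, ?_⟩) (Or.inl ⟨?_, ?_⟩)
    · rw [one_add_one_eq_two]; omega
    · omega
    · omega
    · rw [show 2 * k - 2 + 1 = 2 * k - 1 by omega]; omega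
    · omega
    · rw [show 2 * k - 2 + 1 = 2 * k - 1 by omega]; omega

theorem exists_switch (h : IsCycleWithoutShortLoops k σ) (hk : 1 ≤ k) :
    ∃ a, 1 ≤ a ∧ a ≤ 2 * k ∧ a + 1 ≤ σ a ∧ σ (a + 1) ≤ a := by
  have hfirst := h.mapsTo 1 le_rfl (by omega)
  have hlast := h.mapsTo (2 * k + 1) (by omega) le_rfl
  have hne := h.apply_ne hk (t := 1) le_rfl (by omega)
  obtain ⟨a, h1, h2, h3, h4⟩ := exists_not_and_succ (P := fun t => t + 1 ≤ σ t)
    (x := 1) (y := 2 * k + 1) (by omega) (by omega) (by omega)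
  have := h.apply_ne hk (t := a + 1) (by omega) (by omega)
  exact ⟨a, h1, by omega, h3, by omega⟩

theorem simplePos_or_simpleNeg (h : IsCycleWithoutShortLoops k σ) (hk : 3 ≤ k) :
    SimplePos k σ ∨ SimpleNeg k σ := by
  obtain ⟨a, h1, h2, hr, hl⟩ := h.exists_switch (by omega)
  rcases Nat.lt_or_ge (a + 1) (σ a) with hlt | hge
  · exact (h.simple_of_add_two_le hk h1 h2 hlt hl).imp h.simplePos h.simpleNeg
  rcases Nat.lt_or_ge (σ (a + 1)) a with hlt' | hge'
  · have hmap := h.mapsTo (a + 1) (by omega) (by omega)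
    refine (h.reflect.simple_of_add_two_le hk (a := 2 * k + 1 - a) (by omega) (by omega)
      ?_ ?_).symm.imp (fun hn => h.simplePos fun t ht ht' => ?_)
      (fun hp => h.simpleNeg fun t ht ht' => ?_)
    · rw [show 2 * k + 2 - (2 * k + 1 - a) = a + 1 by omega]; omega
    · rw [show 2 * k + 2 - (2 * k + 1 - a + 1) = a by omega]; omega
    · have := hn (2 * k + 2 - t) (by omega) (by omega)
      rw [show 2 * k + 2 - (2 * k + 2 - t) = t by omega] at this
      omega
    · have := hp (2 * k + 2 - t) (by omega) (by omega)
      rw [show 2 * k + 2 - (2 * k + 2 - t) = t by omega] at this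
      omega
  · have := h.Icc_full (l := a) (r := a + 1) h1 (by omega) (by omega) (fun x hx hx' => by
      obtain rfl | rfl : x = a ∨ x = a + 1 := by omega
      · omega
      · omega)
    omega

end IsCycleWithoutShortLoops

/-- Second minimal `(2k+1)`-orbits are simple. -/
theorem second_minimal_is_simple (k : ℕ) (hk : 3 ≤ k) (f : ℝ → ℝ)
    (hf : Continuous f) (β : ℕ → ℝ) (σ : ℕ → ℕ)
    (horb : IsOrbitWithPerm f (2*k+1) β σ) (hsm : SecondMinimalOrbit f k β) :
    SimplePos k σ ∨ SimpleNeg k σ := by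
  exact (hsm.isCycleWithoutShortLoops (by omega) hf horb).simplePos_or_simpleNeg hk
end

section
/- Let k ≥ 4. Each of the following two permutations π of {1,…,2k+1} is realized by a second minimal (2k+1)-orbit of some continuous map f : ℝ → ℝ: (a) π agrees with the Stefan permutation π_S except π(k−1) = k+2, π(k) = k+4, π(k+1) = k+3; (b) π agrees with π_S except π(1) = k, π(k) = k+2, π(k+1) = k+3, π(k+2) = k+1. -/
/-- The Stefan permutation of `{1,…,2k+1}`. -/
def stefanPerm (k : ℕ) (t : ℕ) : ℕ :=
  if t = 1 then k+1 else if t ≤ k+1 then 2*k+3-t else 2*k+2-t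

/-- The permutation `π` of `{1,…,2k+1}` is realized by a second minimal
`(2k+1)`-orbit of some continuous map. -/
def RealizedSM (k : ℕ) (π : ℕ → ℕ) : Prop :=
  ∃ f : ℝ → ℝ, ∃ β : ℕ → ℝ, Continuous f ∧
    IsOrbitWithPerm f (2*k+1) β π ∧ SecondMinimalOrbit f k β

theorem modEq_iterate_of_shift {m : ℕ} {σ φ : ℕ → ℕ}
    (hσ : ∀ t ∈ Set.Icc 1 m, σ t ∈ Set.Icc 1 m)
    (hshift : ∀ t ∈ Set.Icc 1 m, φ (σ t) ≡ φ t + 1 [MOD m])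
    {t : ℕ} (ht : t ∈ Set.Icc 1 m) (j : ℕ) :
    σ^[j] t ∈ Set.Icc 1 m ∧ φ (σ^[j] t) ≡ φ t + j [MOD m] := by
  induction j with
  | zero => exact ⟨ht, Nat.ModEq.refl _⟩
  | succ j ih =>
    rw [Function.iterate_succ_apply']
    exact ⟨hσ _ ih.1, (hshift _ ih.1).trans (ih.2.add_right 1)⟩

/-- If `φ` conjugates `σ` to the shift modulo `m`, then `{1,…,m}` is an orbit of every map
extending `σ`. -/
theorem isOrbitWithPerm_natCast_of_shift {m : ℕ} {f : ℝ → ℝ} {σ φ : ℕ → ℕ}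
    (hσ : ∀ t ∈ Set.Icc 1 m, σ t ∈ Set.Icc 1 m)
    (hlt : ∀ t ∈ Set.Icc 1 m, φ t < m)
    (hinj : Set.InjOn φ (Set.Icc 1 m))
    (hshift : ∀ t ∈ Set.Icc 1 m, φ (σ t) ≡ φ t + 1 [MOD m])
    (hf : ∀ t ∈ Set.Icc 1 m, f t = σ t) :
    IsOrbitWithPerm f m (fun t => (t : ℝ)) σ := by
  have hiter := fun t ht j => modEq_iterate_of_shift hσ hshift (t := t) ht j
  have hfiter : ∀ t ∈ Set.Icc 1 m, ∀ j, f^[j] (t : ℝ) = (σ^[j] t : ℕ) := by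
    intro t ht j
    induction j with
    | zero => rfl
    | succ j ih =>
      rw [Function.iterate_succ_apply', Function.iterate_succ_apply', ih, hf _ (hiter t ht j).1]
  have hinj' : ∀ s ∈ Set.Icc 1 m, ∀ t ∈ Set.Icc 1 m, φ s ≡ φ t [MOD m] → s = t :=
    fun s hs t ht h => hinj hs ht (h.eq_of_lt_of_lt (hlt s hs) (hlt t ht))
  have hret : ∀ t ∈ Set.Icc 1 m, σ^[m] t = t := fun t ht =>
    hinj' _ (hiter t ht m).1 t ht ((hiter t ht m).2.trans (by simp [Nat.ModEq]))
  refine ⟨fun a _ b _ h => Nat.cast_lt.2 h, fun t ht => ⟨?_, fun j hj1 hjm h => ?_⟩,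
    ⟨hσ, fun s hs t ht h => ?_, fun t ht => ?_⟩, hf⟩
  · rw [hfiter t ht, hret t ht]
  · rw [hfiter t ht, Nat.cast_inj] at h
    have h1 := (hiter t ht j).2
    rw [h] at h1
    have h2 : 0 ≡ j [MOD m] := Nat.ModEq.add_left_cancel' (φ t) (by simpa using h1)
    have := h2.eq_of_lt_of_lt (by omega) hjm
    omega
  · refine hinj' s hs t ht (Nat.ModEq.add_right_cancel' 1 ?_)
    have h1 := (hshift s hs).symm
    rw [h] at h1
    exact h1.trans (hshift t ht)
  · refine ⟨σ^[m - 1] t, (hiter t ht _).1, ?_⟩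
    have hm : 1 ≤ m := ht.1.trans ht.2
    rw [← Function.iterate_succ_apply' σ, Nat.succ_eq_add_one, Nat.sub_add_cancel hm, hret t ht]

/-- A map of `[1, 2K+1]` that exchanges the two sides of a fixed point `z`, except that points of
`[1, 2)` may be sent to `[c, z)`, and whose square decreases points left of `z` slowly. -/
structure SlowReturn (f : ℝ → ℝ) (K z c : ℝ) : Prop where
  maps : ∀ x : ℝ, 1 ≤ x → x ≤ 2 * K + 1 → 1 ≤ f x ∧ f x ≤ 2 * K + 1
  fixed : f z = z
  two_le : 2 ≤ c
  right : ∀ x : ℝ, z < x → x ≤ 2 * K + 1 → f x < z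
  left : ∀ x : ℝ, 2 ≤ x → x < z → z < f x
  inject : ∀ x : ℝ, 1 ≤ x → x < 2 → c ≤ f x
  first : ∀ x : ℝ, c ≤ x → x < z → K - 1 ≤ f (f x)
  step : ∀ s x : ℝ, 3 ≤ s → s ≤ K - 1 → s ≤ x → x < z → s - 1 ≤ f (f x)

namespace SlowReturn

variable {f : ℝ → ℝ} {k : ℕ} {z c : ℝ}

theorem iterate_mem (h : SlowReturn f k z c) {x : ℝ} (hx : 1 ≤ x ∧ x ≤ 2 * k + 1) (j : ℕ) :
    1 ≤ f^[j] x ∧ f^[j] x ≤ 2 * k + 1 := by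
  induction j with
  | zero => exact hx
  | succ j ih =>
    rw [Function.iterate_succ_apply']
    exact h.maps _ ih.1 ih.2

theorem iterate_even (h : SlowReturn f k z c) {w : ℝ} (hw : 1 ≤ w ∧ w ≤ 2 * k + 1)
    (hcw : c ≤ w) (hwz : w < z) (i : ℕ) (hi : i + 3 ≤ k) :
    (k : ℝ) - (i + 1) ≤ f^[2 * (i + 1)] w ∧ f^[2 * (i + 1)] w < z := by
  induction i with
  | zero =>
    have h1 := h.left w (h.two_le.trans hcw) hwz
    have h2 := h.right _ h1 (h.maps w hw.1 hw.2).2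
    have h3 := h.first w hcw hwz
    constructor
    · simpa using h3
    · simpa using h2
  | succ i ih =>
    obtain ⟨h1, h2⟩ := ih (by omega)
    have hk : (i : ℝ) + 1 + 3 ≤ k := by exact_mod_cast hi
    have hmem := h.iterate_mem hw (2 * (i + 1))
    have h3 := h.left _ (by linarith) h2
    have h4 := h.right _ h3 (h.maps _ hmem.1 hmem.2).2
    have h5 := h.step (k - (i + 1)) _ (by linarith)
      (by have : (0 : ℝ) ≤ i := Nat.cast_nonneg i
          linarith) h1 h2
    rw [show 2 * (i + 1 + 1) = 2 * (i + 1) + 1 + 1 by ring, Function.iterate_succ_apply',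
      Function.iterate_succ_apply']
    push_cast
    exact ⟨by linarith, h4⟩

theorem two_le_iterate_even (h : SlowReturn f k z c) {w : ℝ} (hw : 1 ≤ w ∧ w ≤ 2 * k + 1)
    (hcw : c ≤ w) (hwz : w < z) (i : ℕ) (hi : i + 2 ≤ k) : 2 ≤ f^[2 * i] w := by
  cases i with
  | zero => exact h.two_le.trans hcw
  | succ i =>
    have := (h.iterate_even hw hcw hwz i (by omega)).1
    have hk : (i : ℝ) + 1 + 2 ≤ k := by exact_mod_cast hi
    linarith

theorem not_periodicPtOfPeriod (h : SlowReturn f k z c) {q : ℕ} (hodd : Odd q) (hq1 : 1 < q)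
    (hqk : q < 2 * k - 1) {y : ℝ} (hy : 1 ≤ y ∧ y ≤ 2 * k + 1) : ¬ PeriodicPtOfPeriod f q y := by
  rintro ⟨hret, hmin⟩
  have hper : ∀ j, f^[q] (f^[j] y) = f^[j] y := fun j => by
    rw [← Function.iterate_add_apply, add_comm, Function.iterate_add_apply, hret]
  have hne : ∀ j, f^[j] y ≠ z := by
    intro j hj
    have hzfix : ∀ i, f^[i] z = z := fun i => Function.iterate_fixed h.fixed i
    have hyz : y = z := by
      have h1 : f^[q * j] y = y := by
        have : Function.IsPeriodicPt f q y := hret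
        exact this.mul_const j
      have h2 : q * j = (q * j - j) + j :=
        (Nat.sub_add_cancel (Nat.le_mul_of_pos_left j (by omega))).symm
      rw [h2, Function.iterate_add_apply, hj, hzfix] at h1
      exact h1.symm
    exact hmin 1 le_rfl hq1 (by rw [hyz]; exact hzfix 1)
  have hLL : ∃ j, f^[j] y < z ∧ f^[j + 1] y < z := by
    by_contra! hcon
    have halt : ∀ j, f^[j + 1] y < z ↔ ¬ f^[j] y < z := by
      intro j
      refine ⟨fun h1 h2 => absurd h1 (not_lt.2 (hcon j h2)), fun h1 => ?_⟩
      rw [Function.iterate_succ_apply']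
      exact h.right _ (lt_of_le_of_ne (not_lt.1 h1) (hne j).symm) (h.iterate_mem hy j).2
    have hpar : ∀ j, f^[2 * j] y < z ↔ y < z := by
      intro j
      induction j with
      | zero => rfl
      | succ j ih => rw [show 2 * (j + 1) = 2 * j + 1 + 1 by ring, halt, halt, not_not, ih]
    obtain ⟨r, hr⟩ := hodd
    have h1 := halt (2 * r)
    rw [← hr, hret, hpar] at h1
    exact iff_not_self h1
  obtain ⟨j, hj1, hj2⟩ := hLL
  rw [Function.iterate_succ_apply'] at hj2
  have hmem := h.iterate_mem hy j
  have hlt : f^[j] y < 2 := by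
    by_contra! h2
    exact absurd hj2 (not_lt.2 (h.left _ h2 hj1).le)
  obtain ⟨r, hr⟩ := hodd
  have h1 := h.two_le_iterate_even (h.maps _ hmem.1 hmem.2) (h.inject _ hmem.1 hlt) hj2 r (by omega)
  rw [← Function.iterate_succ_apply, Nat.succ_eq_add_one, ← hr, hper] at h1
  linarith

/-- The `(2k+1)`-orbit `{1,…,2k+1}` of a slowly returning map is second minimal as soon as the
inverse square of its permutation reverses the order of a pair of adjacent points away from `z`. -/
theorem realizedSM (h : SlowReturn f k z c) (hf : Continuous f) {π : ℕ → ℕ} (hk : 2 ≤ k)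
    (horb : IsOrbitWithPerm f (2 * k + 1) (fun t => (t : ℝ)) π) {p u v : ℕ}
    (hp : 2 ≤ p) (hpk : p ≤ 2 * k) (hu : u ≤ 2 * k + 1) (hv : 1 ≤ v)
    (hpu : p ≤ u) (hvp : v ≤ p + 1) (hπu : π (π u) = p) (hπv : π (π v) = p + 1)
    (hpz : (p : ℝ) + 1 < z) : RealizedSM k π := by
  have hcast : ((2 * k + 1 : ℕ) : ℝ) = 2 * k + 1 := by push_cast; ring
  have hback : ∀ t ∈ Set.Icc 1 (2 * k + 1), f^[2 * k - 1] (π (π t) : ℕ) = (t : ℝ) := by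
    intro t ht
    have h1 := (horb.2.1 t ht).1
    rw [show 2 * k + 1 = (2 * k - 1) + 1 + 1 by omega, Function.iterate_succ_apply,
      Function.iterate_succ_apply, horb.2.2.2 t ht, horb.2.2.2 _ (horb.2.2.1.1 ht)] at h1
    exact h1
  have hfp : f^[2 * k - 1] (p : ℝ) = u := by
    rw [← hπu]; exact hback u ⟨by omega, hu⟩
  have hfp' : f^[2 * k - 1] ((p : ℝ) + 1) = v := by
    have := hback v ⟨hv, by omega⟩
    rw [hπv] at this
    exact_mod_cast this
  obtain ⟨y, hy, hfy⟩ : ∃ y ∈ Set.Icc (p : ℝ) (p + 1), f^[2 * k - 1] y = y := by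
    have hcont : ContinuousOn (fun x => f^[2 * k - 1] x - x) (Set.Icc (p : ℝ) (p + 1)) :=
      ((hf.iterate _).sub continuous_id).continuousOn
    have hmem : (0 : ℝ) ∈ Set.Icc (f^[2 * k - 1] ((p : ℝ) + 1) - (p + 1))
        (f^[2 * k - 1] (p : ℝ) - p) := by
      rw [hfp, hfp']
      have h1 : (p : ℝ) ≤ u := by exact_mod_cast hpu
      have h2 : (v : ℝ) ≤ p + 1 := by exact_mod_cast hvp
      exact ⟨by linarith, by linarith⟩
    obtain ⟨y, hy, h0⟩ := intermediate_value_Icc' (by linarith) hcont hmem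
    exact ⟨y, hy, sub_eq_zero.1 h0⟩
  have hp' : (2 : ℝ) ≤ p := by exact_mod_cast hp
  have hpk' : (p : ℝ) ≤ 2 * k := by exact_mod_cast hpk
  have hyI : 1 ≤ y ∧ y ≤ 2 * k + 1 := ⟨by linarith [hy.1], by linarith [hy.2]⟩
  have hyfix : f y ≠ y := by
    have := h.left y (by linarith [hy.1]) (by linarith [hy.2])
    exact fun h0 => by linarith [hy.2]
  refine ⟨f, fun t => (t : ℝ), hf, horb, ⟨y, ⟨hfy, ?_⟩, fun j => ?_⟩, ?_⟩
  · intro j hj1 hj2 hj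
    have hper : Function.IsPeriodicPt f (2 * k - 1) y := hfy
    have hdvd := hper.minimalPeriod_dvd
    have hpos : 0 < Function.minimalPeriod f y := hper.minimalPeriod_pos (by omega)
    have hle : Function.minimalPeriod f y ≤ j :=
      Function.IsPeriodicPt.minimalPeriod_le hj1 hj
    have hodd : Odd (Function.minimalPeriod f y) :=
      Odd.of_dvd_nat ⟨k - 1, by omega⟩ hdvd
    have hne : Function.minimalPeriod f y ≠ 1 := fun h1 =>
      hyfix (Function.minimalPeriod_eq_one_iff_isFixedPt.1 h1)
    refine h.not_periodicPtOfPeriod hodd (by omega) (by omega) hyI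
      ⟨Function.iterate_minimalPeriod, fun i hi1 hi2 hi => ?_⟩
    exact absurd (Function.IsPeriodicPt.minimalPeriod_le hi1 hi) (by omega)
  · have := h.iterate_mem hyI j
    simp only [hcast, Nat.cast_one]
    exact this
  · rintro q hodd hq1 hqk ⟨x, hx, hxI⟩
    have := hxI 0
    simp only [hcast, Nat.cast_one, Function.iterate_zero, id] at this
    exact h.not_periodicPtOfPeriod hodd hq1 hqk this hx

end SlowReturn

/-- The piecewise linear map with `π_S` changed to `k-1 ↦ k+2`, `k ↦ k+4`, `k+1 ↦ k+3`. -/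
noncomputable def tripleChangeMap (K x : ℝ) : ℝ :=
  if x ≤ 2 then K + 1 + K * (x - 1)
  else if x ≤ K - 2 then 2 * K + 3 - x
  else if x ≤ K - 1 then K + 5 - 3 * (x - (K - 2))
  else if x ≤ K then K + 2 + 2 * (x - (K - 1))
  else if x ≤ K + 1 then 2 * K + 4 - x
  else if x ≤ K + 2 then K + 3 - 3 * (x - (K + 1))
  else 2 * K + 2 - x

/-- The piecewise linear map with `π_S` changed to `1 ↦ k`, `k ↦ k+2`, `k+1 ↦ k+3`,
`k+2 ↦ k+1`. -/
noncomputable def quadrupleChangeMap (K x : ℝ) : ℝ :=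
  if x ≤ 2 then K + (K + 1) * (x - 1)
  else if x ≤ K - 1 then 2 * K + 3 - x
  else if x ≤ K then K + 4 - 2 * (x - (K - 1))
  else if x ≤ K + 1 then x + 2
  else if x ≤ K + 2 then K + 3 - 2 * (x - (K + 1))
  else if x ≤ K + 3 then K + 1 - 2 * (x - (K + 2))
  else 2 * K + 2 - x

theorem continuous_tripleChangeMap {K : ℝ} (hK : 4 ≤ K) : Continuous (tripleChangeMap K) := by
  unfold tripleChangeMap
  repeat' refine Continuous.if_le ?_ ?_ continuous_id continuous_const ?_
  all_goals first
    | fun_prop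
    | (rintro x rfl; split_ifs <;> linarith)
    | (rintro x rfl; ring)

theorem continuous_quadrupleChangeMap {K : ℝ} (hK : 4 ≤ K) :
    Continuous (quadrupleChangeMap K) := by
  unfold quadrupleChangeMap
  repeat' refine Continuous.if_le ?_ ?_ continuous_id continuous_const ?_
  all_goals first
    | fun_prop
    | (rintro x rfl; split_ifs <;> linarith)
    | (rintro x rfl; ring)

theorem slowReturn_tripleChangeMap {K : ℝ} (hK : 4 ≤ K) :
    SlowReturn (tripleChangeMap K) K (K + 3 / 2) (K + 1) := by
  have hprod : ∀ x : ℝ, 1 ≤ x → x ≤ 2 → 0 ≤ K * (x - 1) ∧ K * (x - 1) ≤ K := fun x h1 h2 =>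
    ⟨by nlinarith, by nlinarith⟩
  have hleft : ∀ x, 2 ≤ x → x < K + 3 / 2 → K + 3 / 2 < tripleChangeMap K x := by
    intro x h1 h2
    unfold tripleChangeMap
    split_ifs with h
    · obtain rfl : x = 2 := le_antisymm h h1
      linarith
    all_goals linarith
  have hupper : ∀ s x, 3 ≤ s → s ≤ K - 1 → s ≤ x → x < K + 3 / 2 →
      tripleChangeMap K x ≤ 2 * K + 3 - s := by
    intro s x h1 h2 h3 h4
    unfold tripleChangeMap
    split_ifs <;> linarith
  have hlower : ∀ s x, s ≤ K → K + 3 / 2 < x → x ≤ 2 * K + 3 - s →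
      s - 1 ≤ tripleChangeMap K x := by
    intro s x h1 h2 h3
    unfold tripleChangeMap
    split_ifs <;> linarith
  constructor
  · intro x h1 h2
    unfold tripleChangeMap
    split_ifs with h
    · have := hprod x h1 h
      constructor <;> linarith
    all_goals constructor <;> linarith
  · unfold tripleChangeMap
    split_ifs <;> linarith
  · linarith
  · intro x h1 h2
    unfold tripleChangeMap
    split_ifs <;> linarith
  · exact hleft
  · intro x h1 h2
    unfold tripleChangeMap
    rw [if_pos h2.le]
    linarith [(hprod x h1 h2.le).1]
  · intro x h1 h2
    refine hlower K _ le_rfl (hleft x (by linarith) h2) ?_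
    unfold tripleChangeMap
    split_ifs <;> linarith
  · intro s x h1 h2 h3 h4
    exact hlower s _ (by linarith) (hleft x (by linarith) h4) (hupper s x h1 h2 h3 h4)

theorem slowReturn_quadrupleChangeMap {K : ℝ} (hK : 4 ≤ K) :
    SlowReturn (quadrupleChangeMap K) K (K + 5 / 3) K := by
  have hprod : ∀ x : ℝ, 1 ≤ x → x ≤ 2 → 0 ≤ (K + 1) * (x - 1) ∧ (K + 1) * (x - 1) ≤ K + 1 :=
    fun x h1 h2 => ⟨by nlinarith, by nlinarith⟩
  have hleft : ∀ x, 2 ≤ x → x < K + 5 / 3 → K + 5 / 3 < quadrupleChangeMap K x := by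
    intro x h1 h2
    unfold quadrupleChangeMap
    split_ifs with h
    · obtain rfl : x = 2 := le_antisymm h h1
      linarith
    all_goals linarith
  have hupper : ∀ s x, 3 ≤ s → s ≤ K → s ≤ x → x < K + 5 / 3 →
      quadrupleChangeMap K x ≤ 2 * K + 3 - s := by
    intro s x h1 h2 h3 h4
    unfold quadrupleChangeMap
    split_ifs <;> linarith
  have hlower : ∀ s x, s ≤ K → K + 5 / 3 < x → x ≤ 2 * K + 3 - s →
      s - 1 ≤ quadrupleChangeMap K x := by
    intro s x h1 h2 h3
    unfold quadrupleChangeMap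
    split_ifs <;> linarith
  constructor
  · intro x h1 h2
    unfold quadrupleChangeMap
    split_ifs with h
    · have := hprod x h1 h
      constructor <;> linarith
    all_goals constructor <;> linarith
  · unfold quadrupleChangeMap
    split_ifs <;> linarith
  · linarith
  · intro x h1 h2
    unfold quadrupleChangeMap
    split_ifs <;> linarith
  · exact hleft
  · intro x h1 h2
    unfold quadrupleChangeMap
    rw [if_pos h2.le]
    linarith [(hprod x h1 h2.le).1]
  · intro x h1 h2
    exact hlower K _ le_rfl (hleft x (by linarith) h2) (hupper K x (by linarith) le_rfl h1 h2)
  · intro s x h1 h2 h3 h4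
    exact hlower s _ (by linarith) (hleft x (by linarith) h4)
      (hupper s x h1 (by linarith) h3 h4)

theorem modEq_of_eq_or {m a b : ℕ} (h : a = b ∨ a + m = b) : a ≡ b [MOD m] := by
  rcases h with rfl | rfl
  · rfl
  · simp [Nat.ModEq]

/-- The permutation of `{1,…,2k+1}` induced by `tripleChangeMap k`. -/
def tripleChangePerm (k t : ℕ) : ℕ :=
  if t = k-1 then k+2 else if t = k then k+4 else if t = k+1 then k+3
  else stefanPerm k t

theorem tripleChangePerm_cases {k t r : ℕ} (hk : 4 ≤ k) (h1 : 1 ≤ t) (h2 : t ≤ 2 * k + 1)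
    (hr : tripleChangePerm k t = r) :
    t = 1 ∧ r = k + 1 ∨ 2 ≤ t ∧ t + 2 ≤ k ∧ r + t = 2 * k + 3 ∨ t + 1 = k ∧ r = k + 2 ∨
      t = k ∧ r = k + 4 ∨ t = k + 1 ∧ r = k + 3 ∨ k + 2 ≤ t ∧ r + t = 2 * k + 2 := by
  unfold tripleChangePerm stefanPerm at hr
  split_ifs at hr <;> omega

theorem tripleChangeMap_natCast {k t : ℕ} (hk : 4 ≤ k) (h1 : 1 ≤ t) (h2 : t ≤ 2 * k + 1) :
    tripleChangeMap k t = tripleChangePerm k t := by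
  generalize hr : tripleChangePerm k t = r
  have hK : (4 : ℝ) ≤ k := by exact_mod_cast hk
  rcases tripleChangePerm_cases hk h1 h2 hr with h | h | h | h | h | h
  · obtain ⟨rfl, rfl⟩ := h
    simp [tripleChangeMap]
  all_goals
    rify at h
    unfold tripleChangeMap
    split_ifs with h3
  all_goals first
    | linarith
    | (have h4 : (t : ℝ) = 2 := by linarith
       rw [h4] at h ⊢
       linarith)

theorem isOrbitWithPerm_tripleChangeMap {k : ℕ} (hk : 4 ≤ k) :
    IsOrbitWithPerm (tripleChangeMap k) (2 * k + 1) (fun t => (t : ℝ)) (tripleChangePerm k) := by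
  let φ : ℕ → ℕ := fun t =>
    if t = 1 then 0 else if t = k + 1 then 1 else if t = k + 3 then 2 else if t = k - 1 then 3
    else if t = k + 2 then 4 else if t = k then 5 else if t ≤ k then 2 * (k - t) + 3
    else 2 * (t - k) - 2
  have hφ : ∀ t, 1 ≤ t → t ≤ 2 * k + 1 →
      t = 1 ∧ φ t = 0 ∨ t = k + 1 ∧ φ t = 1 ∨ t = k + 3 ∧ φ t = 2 ∨
      t + 1 = k ∧ φ t = 3 ∨ t = k + 2 ∧ φ t = 4 ∨ t = k ∧ φ t = 5 ∨
      2 ≤ t ∧ t + 2 ≤ k ∧ φ t + 2 * t = 2 * k + 3 ∨ k + 4 ≤ t ∧ φ t + 2 * k + 2 = 2 * t := by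
    intro t h1 h2
    simp only [φ]
    split_ifs <;> omega
  clear_value φ
  refine isOrbitWithPerm_natCast_of_shift (φ := φ) ?_ ?_ ?_ ?_
    (fun t ht => tripleChangeMap_natCast hk ht.1 ht.2)
  · rintro t ⟨h1, h2⟩
    have := tripleChangePerm_cases hk h1 h2 rfl
    rw [Set.mem_Icc]
    omega
  · rintro t ⟨h1, h2⟩
    have := hφ t h1 h2
    omega
  · rintro s ⟨h1, h2⟩ t ⟨h3, h4⟩ h
    have := hφ s h1 h2
    have := hφ t h3 h4
    omega
  · rintro t ⟨h1, h2⟩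
    apply modEq_of_eq_or
    generalize hr : tripleChangePerm k t = r
    have ht := hφ t h1 h2
    rcases tripleChangePerm_cases hk h1 h2 hr with h | h | h | h | h | h <;>
      have hr := hφ r (by omega) (by omega) <;> omega

/-- The permutation of `{1,…,2k+1}` induced by `quadrupleChangeMap k`. -/
def quadrupleChangePerm (k t : ℕ) : ℕ :=
  if t = 1 then k else if t = k then k+2 else if t = k+1 then k+3
  else if t = k+2 then k+1 else stefanPerm k t

theorem quadrupleChangePerm_cases {k t r : ℕ} (hk : 4 ≤ k) (h1 : 1 ≤ t) (h2 : t ≤ 2 * k + 1)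
    (hr : quadrupleChangePerm k t = r) :
    t = 1 ∧ r = k ∨ 2 ≤ t ∧ t + 1 ≤ k ∧ r + t = 2 * k + 3 ∨ t = k ∧ r = k + 2 ∨
      t = k + 1 ∧ r = k + 3 ∨ t = k + 2 ∧ r = k + 1 ∨ k + 3 ≤ t ∧ r + t = 2 * k + 2 := by
  unfold quadrupleChangePerm stefanPerm at hr
  split_ifs at hr <;> omega

theorem quadrupleChangeMap_natCast {k t : ℕ} (hk : 4 ≤ k) (h1 : 1 ≤ t) (h2 : t ≤ 2 * k + 1) :
    quadrupleChangeMap k t = quadrupleChangePerm k t := by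
  generalize hr : quadrupleChangePerm k t = r
  have hK : (4 : ℝ) ≤ k := by exact_mod_cast hk
  rcases quadrupleChangePerm_cases hk h1 h2 hr with h | h | h | h | h | h
  · obtain ⟨rfl, rfl⟩ := h
    simp [quadrupleChangeMap]
  all_goals
    rify at h
    unfold quadrupleChangeMap
    split_ifs with h3
  all_goals first
    | linarith
    | (have h4 : (t : ℝ) = 2 := by linarith
       rw [h4] at h ⊢
       linarith)

theorem isOrbitWithPerm_quadrupleChangeMap {k : ℕ} (hk : 4 ≤ k) :
    IsOrbitWithPerm (quadrupleChangeMap k) (2 * k + 1) (fun t => (t : ℝ)) (quadrupleChangePerm k) := by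
  let φ : ℕ → ℕ := fun t =>
    if t = 1 then 0 else if t = k then 1 else if t = k + 2 then 2 else if t = k + 1 then 3
    else if t ≤ k then 2 * (k - t) + 3 else 2 * (t - k) - 2
  have hφ : ∀ t, 1 ≤ t → t ≤ 2 * k + 1 →
      t = 1 ∧ φ t = 0 ∨ t = k ∧ φ t = 1 ∨ t = k + 2 ∧ φ t = 2 ∨ t = k + 1 ∧ φ t = 3 ∨
      2 ≤ t ∧ t + 1 ≤ k ∧ φ t + 2 * t = 2 * k + 3 ∨ k + 3 ≤ t ∧ φ t + 2 * k + 2 = 2 * t := by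
    intro t h1 h2
    simp only [φ]
    split_ifs <;> omega
  clear_value φ
  refine isOrbitWithPerm_natCast_of_shift (φ := φ) ?_ ?_ ?_ ?_
    (fun t ht => quadrupleChangeMap_natCast hk ht.1 ht.2)
  · rintro t ⟨h1, h2⟩
    have := quadrupleChangePerm_cases hk h1 h2 rfl
    rw [Set.mem_Icc]
    omega
  · rintro t ⟨h1, h2⟩
    have := hφ t h1 h2
    omega
  · rintro s ⟨h1, h2⟩ t ⟨h3, h4⟩ h
    have := hφ s h1 h2
    have := hφ t h3 h4
    omega
  · rintro t ⟨h1, h2⟩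
    apply modEq_of_eq_or
    generalize hr : quadrupleChangePerm k t = r
    have ht := hφ t h1 h2
    rcases quadrupleChangePerm_cases hk h1 h2 hr with h | h | h | h | h | h <;>
      have hr := hφ r (by omega) (by omega) <;> omega

/-- The two second minimal permutations arising when `m = 2k−1`
(Lemma on the case of path length `2k−1`). -/
theorem realized_m_eq_2k_minus_1 (k : ℕ) (hk : 4 ≤ k) :
    RealizedSM k (fun t =>
      if t = k-1 then k+2 else if t = k then k+4 else if t = k+1 then k+3
      else stefanPerm k t) ∧
    RealizedSM k (fun t =>
      if t = 1 then k else if t = k then k+2 else if t = k+1 then k+3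
      else if t = k+2 then k+1 else stefanPerm k t) := by
  have hK : (4 : ℝ) ≤ k := by exact_mod_cast hk
  constructor
  · refine (slowReturn_tripleChangeMap hK).realizedSM (continuous_tripleChangeMap hK) (by omega)
      (isOrbitWithPerm_tripleChangeMap hk) (p := k - 1) (u := k + 1) (v := k - 1)
      (by omega) (by omega) (by omega) (by omega) (by omega) (by omega) ?_ ?_ ?_
    · grind [tripleChangePerm, stefanPerm]
    · grind [tripleChangePerm, stefanPerm]
    · rw [Nat.cast_sub (by omega)]
      push_cast
      linarith
  · refine (slowReturn_quadrupleChangeMap hK).realizedSM (continuous_quadrupleChangeMap hK)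
      (by omega) (isOrbitWithPerm_quadrupleChangeMap hk) (p := k) (u := 2 * k + 1) (v := k)
      (by omega) (by omega) (by omega) (by omega) (by omega) (by omega) ?_ ?_ ?_
    · grind [quadrupleChangePerm, stefanPerm]
    · grind [quadrupleChangePerm, stefanPerm]
    · linarith
end
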